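/- Let V = 2V_2 ⊕ V_3 (two quadratic forms and one cubic form) and R = O(V)^{SL(2,ℂ)}. Then R has a homogeneous system of parameters consisting of seven invariants, of degrees 2, 2, 3, 4, 5, 5, 6, and the minimal number of algebra generators of R equals 18 (with 3 generators of degree 2, 2 of degree 3, 2 of degree 4, 4 of degree 5, 3 of degree 6, and 4 of degree 7). -/

import Mathlib

open MvPolynomial

noncomputable section

namespace BinInv

/-- `k`-fold partial derivative with respect to the variable `v`. -/
def pd {A : Type*} [CommSemiring A] (v : Fin 2) (k : ℕ)
    (f : MvPolynomial (Fin 2) A) : MvPolynomial (Fin 2) A :=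
  (fun g => MvPolynomial.pderiv v g)^[k] f

/-- The `p`-th transvectant of binary forms `g`, `h` of degrees `m`, `n`,
with coefficients in a commutative `ℂ`-algebra `A`. -/
def transvectant {A : Type*} [CommRing A] [Algebra ℂ A] (m n p : ℕ)
    (g h : MvPolynomial (Fin 2) A) : MvPolynomial (Fin 2) A :=
  algebraMap ℂ (MvPolynomial (Fin 2) A)
      ((((m - p).factorial * (n - p).factorial : ℕ) : ℂ) /
        (((m.factorial * n.factorial : ℕ)) : ℂ)) *
    ∑ i ∈ Finset.range (p + 1),
      algebraMap ℂ (MvPolynomial (Fin 2) A) ((-1 : ℂ) ^ i * (p.choose i : ℂ)) *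
        (pd 0 (p - i) (pd 1 i g) * pd 0 i (pd 1 (p - i) h))

variable {p : ℕ}

/-- Index type for the coefficients of a system of binary forms of degrees `n 0, …, n (p-1)`:
the space `V = V_{n 0} ⊕ … ⊕ V_{n (p-1)}` is identified with `Idx n → ℂ`. -/
abbrev Idx (n : Fin p → ℕ) : Type := Σ i : Fin p, Fin (n i + 1)

/-- The binary form of degree `n i` with coefficient vector `c`. -/
def formAt (n : Fin p → ℕ) (c : Idx n → ℂ) (i : Fin p) : MvPolynomial (Fin 2) ℂ :=
  ∑ k : Fin (n i + 1), C (c ⟨i, k⟩) * X 0 ^ (n i - (k : ℕ)) * X 1 ^ (k : ℕ)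

/-- The substitution action of `SL(2,ℂ)` on binary forms: `(g • f)(v) = f (g⁻¹ • v)`. -/
def sl2Act (g : Matrix.SpecialLinearGroup (Fin 2) ℂ) (f : MvPolynomial (Fin 2) ℂ) :
    MvPolynomial (Fin 2) ℂ :=
  aeval (fun i => ∑ j, C ((↑(g⁻¹) : Matrix (Fin 2) (Fin 2) ℂ) i j) * X j) f

/-- The coefficient of `x^(n-k) y^k` in a binary form. -/
def coeffAt (n : Fin p → ℕ) (j : Idx n) (f : MvPolynomial (Fin 2) ℂ) : ℂ :=
  MvPolynomial.coeff
    (Finsupp.single 0 (n j.1 - (j.2 : ℕ)) + Finsupp.single 1 (j.2 : ℕ)) f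

/-- The induced action of `SL(2,ℂ)` on points of `V`, in coefficient coordinates. -/
def actPt (n : Fin p → ℕ) (g : Matrix.SpecialLinearGroup (Fin 2) ℂ) (c : Idx n → ℂ) :
    Idx n → ℂ :=
  fun j => coeffAt n j (sl2Act g (formAt n c j.1))

/-- A polynomial function on `V` is invariant if it is constant on `SL(2,ℂ)`-orbits. -/
def IsInvariant (n : Fin p → ℕ) (P : MvPolynomial (Idx n) ℂ) : Prop :=
  ∀ (g : Matrix.SpecialLinearGroup (Fin 2) ℂ) (c : Idx n → ℂ),
    eval (actPt n g c) P = eval c P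

/-- The invariant ring `R = O(V)^{SL(2,ℂ)}` as a subalgebra of `O(V)`. -/
def invariantRing (n : Fin p → ℕ) : Subalgebra ℂ (MvPolynomial (Idx n) ℂ) where
  carrier := {P | IsInvariant n P}
  mul_mem' := fun ha hb g c => by
    simp only [map_mul]; rw [ha g c, hb g c]
  one_mem' := fun g c => by simp
  add_mem' := fun ha hb g c => by
    simp only [map_add]; rw [ha g c, hb g c]
  zero_mem' := fun g c => by simp
  algebraMap_mem' := fun r g c => by simp

/-- The nullcone: the points of `V` where every homogeneous invariant of positive
degree vanishes. -/
def Nullcone (n : Fin p → ℕ) : Set (Idx n → ℂ) :=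
  {c | ∀ P ∈ invariantRing n, ∀ d : ℕ, 0 < d → P.IsHomogeneous d → eval c P = 0}

/-- `P` is a homogeneous system of parameters of the invariant ring, with degrees `d`:
the `P j` are homogeneous invariants of positive degrees `d j`, algebraically independent
over `ℂ`, and the invariant ring is integral over the subalgebra they generate. -/
def IsHSOP (n : Fin p → ℕ) {k : ℕ} (P : Fin k → MvPolynomial (Idx n) ℂ)
    (d : Fin k → ℕ) : Prop :=
  (∀ j, P j ∈ invariantRing n) ∧ (∀ j, 0 < d j) ∧
    (∀ j, (P j).IsHomogeneous (d j)) ∧ AlgebraicIndependent ℂ P ∧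
    ∀ x ∈ invariantRing n, IsIntegral (↥(Algebra.adjoin ℂ (Set.range P))) x

/-- `r` is the minimal number of generators of the invariant ring. -/
def IsMinimalNumGens (n : Fin p → ℕ) (r : ℕ) : Prop :=
  IsLeast {k | ∃ S : Finset (MvPolynomial (Idx n) ℂ),
    S.card = k ∧ Algebra.adjoin ℂ (S : Set (MvPolynomial (Idx n) ℂ)) = invariantRing n} r

/-- The invariant ring has minimal number of generators `r`, realized by a minimal
system of homogeneous generators of degrees `d 0, …, d (r-1)`. -/
def HasMinimalGens (n : Fin p → ℕ) {r : ℕ} (d : Fin r → ℕ) : Prop :=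
  IsMinimalNumGens n r ∧
    ∃ G : Fin r → MvPolynomial (Idx n) ℂ, Function.Injective G ∧
      (∀ j, (G j).IsHomogeneous (d j)) ∧
      Algebra.adjoin ℂ (Set.range G) = invariantRing n

/-- The generic binary form of degree `n i`, whose coefficients are the corresponding
coordinate functions on `V`. -/
def genForm (n : Fin p → ℕ) (i : Fin p) :
    MvPolynomial (Fin 2) (MvPolynomial (Idx n) ℂ) :=
  ∑ k : Fin (n i + 1), C (X ⟨i, k⟩) * X 0 ^ (n i - (k : ℕ)) * X 1 ^ (k : ℕ)

end BinInv

end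

namespace BinInv

/-! ### Points and covariants -/

section Covariants

variable {B : Type*} [CommRing B]

/-- The point of `2V₂ ⊕ V₃` with the given coefficient vectors. -/
def point (u v : Fin 3 → B) (f : Fin 4 → B) : Idx ![2, 2, 3] → B
  | ⟨0, k⟩ => u k
  | ⟨1, k⟩ => v k
  | ⟨2, k⟩ => f k

/-- The invariant bilinear pairing of two binary quadratics. -/
def pairing (q r : Fin 3 → B) : B := 2 * q 0 * r 2 - q 1 * r 1 + 2 * q 2 * r 0

/-- The Hessian of a binary cubic, up to a scalar. -/
def hess (f : Fin 4 → B) : Fin 3 → B :=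
  ![3 * f 0 * f 2 - f 1 ^ 2, 9 * f 0 * f 3 - f 1 * f 2, 3 * f 1 * f 3 - f 2 ^ 2]

/-- The Jacobian of two binary quadratics. -/
def cross (u v : Fin 3 → B) : Fin 3 → B :=
  ![u 0 * v 1 - v 0 * u 1, 2 * (u 0 * v 2 - v 0 * u 2), u 1 * v 2 - v 1 * u 2]

/-- The Jacobian of a binary cubic and a binary quadratic. -/
def jac (f : Fin 4 → B) (h : Fin 3 → B) : Fin 4 → B :=
  ![3 * f 0 * h 1 - 2 * f 1 * h 0, 6 * f 0 * h 2 + f 1 * h 1 - 4 * f 2 * h 0,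
    4 * f 1 * h 2 - f 2 * h 1 - 6 * f 3 * h 0, 2 * f 2 * h 2 - 3 * f 3 * h 1]

/-- The second transvectant of a binary cubic and a binary quadratic. -/
def lin (f : Fin 4 → B) (q : Fin 3 → B) : Fin 2 → B :=
  ![q 0 * f 2 - q 1 * f 1 + 3 * q 2 * f 0, 3 * q 0 * f 3 - q 1 * f 2 + q 2 * f 1]

/-- A quadratic paired with the product of two linear forms. -/
def bil (q : Fin 3 → B) (l m : Fin 2 → B) : B :=
  2 * q 0 * l 1 * m 1 - q 1 * (l 0 * m 1 + l 1 * m 0) + 2 * q 2 * l 0 * m 0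

/-- Substitution `x ↦ αx + βy`, `y ↦ γx + δy` in a linear form. -/
def sub₁ (α β γ δ : B) (l : Fin 2 → B) : Fin 2 → B :=
  ![l 0 * α + l 1 * γ, l 0 * β + l 1 * δ]

/-- Substitution `x ↦ αx + βy`, `y ↦ γx + δy` in a quadratic form. -/
def sub₂ (α β γ δ : B) (q : Fin 3 → B) : Fin 3 → B :=
  ![q 0 * α ^ 2 + q 1 * (α * γ) + q 2 * γ ^ 2,
    2 * q 0 * α * β + q 1 * (α * δ + β * γ) + 2 * q 2 * γ * δ,
    q 0 * β ^ 2 + q 1 * (β * δ) + q 2 * δ ^ 2]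

/-- Substitution `x ↦ αx + βy`, `y ↦ γx + δy` in a cubic form. -/
def sub₃ (α β γ δ : B) (f : Fin 4 → B) : Fin 4 → B :=
  ![f 0 * α ^ 3 + f 1 * (α ^ 2 * γ) + f 2 * (α * γ ^ 2) + f 3 * γ ^ 3,
    3 * f 0 * α ^ 2 * β + f 1 * (α ^ 2 * δ + 2 * α * β * γ) +
      f 2 * (2 * α * γ * δ + β * γ ^ 2) + 3 * f 3 * γ ^ 2 * δ,
    3 * f 0 * α * β ^ 2 + f 1 * (2 * α * β * δ + β ^ 2 * γ) +
      f 2 * (α * δ ^ 2 + 2 * β * γ * δ) + 3 * f 3 * γ * δ ^ 2,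
    f 0 * β ^ 3 + f 1 * (β ^ 2 * δ) + f 2 * (β * δ ^ 2) + f 3 * δ ^ 3]

variable {α β γ δ : B}

theorem pairing_sub (h : α * δ - β * γ = 1) (q r : Fin 3 → B) :
    pairing (sub₂ α β γ δ q) (sub₂ α β γ δ r) = pairing q r := by
  have : pairing (sub₂ α β γ δ q) (sub₂ α β γ δ r) =
      (α * δ - β * γ) ^ 2 * pairing q r := by
    simp [pairing, sub₂]; ring
  rw [this, h]; ring

theorem hess_sub (h : α * δ - β * γ = 1) (f : Fin 4 → B) :
    hess (sub₃ α β γ δ f) = sub₂ α β γ δ (hess f) := by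
  have : hess (sub₃ α β γ δ f) = (α * δ - β * γ) ^ 2 • sub₂ α β γ δ (hess f) := by
    ext i; fin_cases i <;> simp [hess, sub₂, sub₃] <;> ring
  rw [this, h]; simp

theorem cross_sub (h : α * δ - β * γ = 1) (q r : Fin 3 → B) :
    cross (sub₂ α β γ δ q) (sub₂ α β γ δ r) = sub₂ α β γ δ (cross q r) := by
  have : cross (sub₂ α β γ δ q) (sub₂ α β γ δ r) =
      (α * δ - β * γ) • sub₂ α β γ δ (cross q r) := by
    ext i; fin_cases i <;> simp [cross, sub₂] <;> ring
  rw [this, h]; simp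

theorem jac_sub (h : α * δ - β * γ = 1) (f : Fin 4 → B) (q : Fin 3 → B) :
    jac (sub₃ α β γ δ f) (sub₂ α β γ δ q) = sub₃ α β γ δ (jac f q) := by
  have : jac (sub₃ α β γ δ f) (sub₂ α β γ δ q) =
      (α * δ - β * γ) • sub₃ α β γ δ (jac f q) := by
    ext i; fin_cases i <;> simp [jac, sub₂, sub₃] <;> ring
  rw [this, h]; simp

theorem lin_sub (h : α * δ - β * γ = 1) (f : Fin 4 → B) (q : Fin 3 → B) :
    lin (sub₃ α β γ δ f) (sub₂ α β γ δ q) = sub₁ α β γ δ (lin f q) := by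
  have : lin (sub₃ α β γ δ f) (sub₂ α β γ δ q) =
      (α * δ - β * γ) ^ 2 • sub₁ α β γ δ (lin f q) := by
    ext i; fin_cases i <;> simp [lin, sub₁, sub₂, sub₃] <;> ring
  rw [this, h]; simp

theorem bil_sub (h : α * δ - β * γ = 1) (q : Fin 3 → B) (l m : Fin 2 → B) :
    bil (sub₂ α β γ δ q) (sub₁ α β γ δ l) (sub₁ α β γ δ m) = bil q l m := by
  have : bil (sub₂ α β γ δ q) (sub₁ α β γ δ l) (sub₁ α β γ δ m) =
      (α * δ - β * γ) ^ 2 * bil q l m := by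
    simp [bil, sub₁, sub₂]; ring
  rw [this, h]; ring

/-- The values of the eighteen basic invariants at a point. -/
def basicVal (u v : Fin 3 → B) (f : Fin 4 → B) : Fin 18 → B :=
  ![pairing u u, pairing u v, pairing v v,
    pairing u (hess f), pairing v (hess f),
    pairing (hess f) (hess f), pairing (cross u v) (hess f),
    bil u (lin f u) (lin f u), bil v (lin f u) (lin f u),
    bil u (lin f v) (lin f v), bil v (lin f v) (lin f v),
    bil (cross u v) (lin f u) (lin f u), bil (cross u v) (lin f u) (lin f v),
    bil (cross u v) (lin f v) (lin f v),
    bil u (lin f u) (lin (jac f (hess f)) u), bil v (lin f u) (lin (jac f (hess f)) u),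
    bil u (lin f v) (lin (jac f (hess f)) v), bil v (lin f v) (lin (jac f (hess f)) v)]

theorem basicVal_sub (h : α * δ - β * γ = 1) (u v : Fin 3 → B) (f : Fin 4 → B) :
    basicVal (sub₂ α β γ δ u) (sub₂ α β γ δ v) (sub₃ α β γ δ f) = basicVal u v f := by
  simp only [basicVal, hess_sub h, cross_sub h, jac_sub h, lin_sub h, pairing_sub h, bil_sub h]

theorem map_basicVal {B' : Type*} [CommRing B'] (φ : B →+* B') (u v : Fin 3 → B)
    (f : Fin 4 → B) (i : Fin 18) :
    φ (basicVal u v f i) = basicVal (φ ∘ u) (φ ∘ v) (φ ∘ f) i := by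
  fin_cases i <;> simp [basicVal, pairing, hess, cross, jac, lin, bil,
    map_ofNat φ 2, map_ofNat φ 3, map_ofNat φ 4, map_ofNat φ 6, map_ofNat φ 9]

theorem map_point {B' : Type*} [CommRing B'] (φ : B →+* B') (u v : Fin 3 → B)
    (f : Fin 4 → B) : (fun j => φ (point u v f j)) = point (φ ∘ u) (φ ∘ v) (φ ∘ f) := by
  ext ⟨i, k⟩; fin_cases i <;> rfl

end Covariants

theorem eq_point {B : Type*} (c : Idx ![2, 2, 3] → B) :
    c = point (fun k => c ⟨0, k⟩) (fun k => c ⟨1, k⟩) (fun k => c ⟨2, k⟩) := by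
  ext ⟨i, k⟩; fin_cases i <;> rfl

/-- The polynomial functions on `2V₂ ⊕ V₃`. -/
abbrev Poly : Type := MvPolynomial (Idx ![2, 2, 3]) ℂ

/-- The invariants of `2V₂ ⊕ V₃`. -/
noncomputable abbrev Inv : Subalgebra ℂ Poly := invariantRing ![2, 2, 3]

/-- The eighteen basic invariants. -/
noncomputable def basic : Fin 18 → Poly :=
  basicVal (fun k => X ⟨0, k⟩) (fun k => X ⟨1, k⟩) (fun k => X ⟨2, k⟩)

theorem aeval_basic {B : Type*} [CommRing B] [Algebra ℂ B] (u v : Fin 3 → B) (f : Fin 4 → B)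
    (i : Fin 18) : aeval (point u v f) (basic i) = basicVal u v f i := by
  have := map_basicVal (aeval (R := ℂ) (point u v f)).toRingHom (fun k => X ⟨0, k⟩)
    (fun k => X ⟨1, k⟩) (fun k => X ⟨2, k⟩) i
  refine this.trans ?_
  congr 1 <;> · ext k; simp [point]

theorem eval_basic (u v : Fin 3 → ℂ) (f : Fin 4 → ℂ) (i : Fin 18) :
    eval (point u v f) (basic i) = basicVal u v f i := by
  rw [← aeval_basic, aeval_eq_eval]

/-! ### The action in coordinates -/

theorem coeffAt_formAt {p : ℕ} (n : Fin p → ℕ) (c : Idx n → ℂ) (j : Idx n) :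
    coeffAt n j (formAt n c j.1) = c j := by
  have hmon : ∀ k : Fin (n j.1 + 1), (C (c ⟨j.1, k⟩) * X 0 ^ (n j.1 - (k : ℕ)) * X 1 ^ (k : ℕ) :
      MvPolynomial (Fin 2) ℂ) =
      monomial (Finsupp.single 0 (n j.1 - (k : ℕ)) + Finsupp.single 1 (k : ℕ)) (c ⟨j.1, k⟩) := by
    intro k
    rw [X_pow_eq_monomial, X_pow_eq_monomial, C_mul_monomial, monomial_mul]
    simp
  simp only [coeffAt, formAt, hmon, coeff_sum, coeff_monomial]
  rw [Finset.sum_eq_single j.2]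
  · simp
  · intro k _ hk
    rw [if_neg]
    intro h
    have := DFunLike.congr_fun h 1
    simp at this
    exact hk (Fin.ext this)
  · simp

theorem actPt_point (g : Matrix.SpecialLinearGroup (Fin 2) ℂ) (u v : Fin 3 → ℂ)
    (f : Fin 4 → ℂ) :
    actPt ![2, 2, 3] g (point u v f) =
      point (sub₂ (g⁻¹.1 0 0) (g⁻¹.1 0 1) (g⁻¹.1 1 0) (g⁻¹.1 1 1) u)
        (sub₂ (g⁻¹.1 0 0) (g⁻¹.1 0 1) (g⁻¹.1 1 0) (g⁻¹.1 1 1) v)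
        (sub₃ (g⁻¹.1 0 0) (g⁻¹.1 0 1) (g⁻¹.1 1 0) (g⁻¹.1 1 1) f) := by
  ext j
  rw [← coeffAt_formAt ![2, 2, 3] (point (sub₂ _ _ _ _ u) (sub₂ _ _ _ _ v) (sub₃ _ _ _ _ f)) j]
  unfold actPt
  congr 1
  obtain ⟨i, k⟩ := j
  simp only [sl2Act]
  generalize (g⁻¹ : Matrix.SpecialLinearGroup (Fin 2) ℂ).1 = M
  fin_cases i
  · change aeval _ (∑ k : Fin 3, C (u k) * X 0 ^ (2 - (k : ℕ)) * X 1 ^ (k : ℕ)) =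
      ∑ k : Fin 3, C (sub₂ _ _ _ _ u k) * X 0 ^ (2 - (k : ℕ)) * X 1 ^ (k : ℕ)
    simp [Fin.sum_univ_succ, sub₂, map_ofNat C 2]
    ring
  · change aeval _ (∑ k : Fin 3, C (v k) * X 0 ^ (2 - (k : ℕ)) * X 1 ^ (k : ℕ)) =
      ∑ k : Fin 3, C (sub₂ _ _ _ _ v k) * X 0 ^ (2 - (k : ℕ)) * X 1 ^ (k : ℕ)
    simp [Fin.sum_univ_succ, sub₂, map_ofNat C 2]
    ring
  · change aeval _ (∑ k : Fin 4, C (f k) * X 0 ^ (3 - (k : ℕ)) * X 1 ^ (k : ℕ)) =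
      ∑ k : Fin 4, C (sub₃ _ _ _ _ f k) * X 0 ^ (3 - (k : ℕ)) * X 1 ^ (k : ℕ)
    simp [Fin.sum_univ_succ, sub₃, map_ofNat C 2, map_ofNat C 3]
    ring

theorem mem_inv_iff {P : Poly} : P ∈ Inv ↔ ∀ (α β γ δ : ℂ), α * δ - β * γ = 1 →
    ∀ u v f, eval (point (sub₂ α β γ δ u) (sub₂ α β γ δ v) (sub₃ α β γ δ f)) P =
      eval (point u v f) P := by
  constructor
  · intro hP α β γ δ h u v f
    let g : Matrix.SpecialLinearGroup (Fin 2) ℂ :=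
      ⟨!![α, β; γ, δ], by rw [Matrix.det_fin_two_of, h]⟩
    have := hP g⁻¹ (point u v f)
    rw [actPt_point, inv_inv] at this
    exact this
  · intro h g c
    rw [eq_point c, actPt_point]
    apply h
    have := g⁻¹.2
    rwa [Matrix.det_fin_two] at this

theorem basic_mem (i : Fin 18) : basic i ∈ Inv := by
  rw [mem_inv_iff]
  intro α β γ δ h u v f
  rw [eval_basic, eval_basic, basicVal_sub h]

/-! ### Gradings -/

section Gradings

variable {σ : Type*}

theorem eval_eq_aeval (c : σ → ℂ) (P : MvPolynomial σ ℂ) : eval c P = aeval c P := by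
  rw [aeval_eq_eval]

theorem coeff_aeval_C_mul_X (a : σ → ℂ) (P : MvPolynomial σ ℂ) (d : σ →₀ ℕ) :
    coeff d (aeval (fun j => C (a j) * X j : σ → MvPolynomial σ ℂ) P) =
      coeff d P * d.prod fun j e => a j ^ e := by
  classical
  induction P using MvPolynomial.induction_on' with
  | monomial e c =>
    rw [aeval_monomial]
    have : (e.prod fun j k => (C (a j) * X j : MvPolynomial σ ℂ) ^ k) =
        monomial e (e.prod fun j k => a j ^ k) := by
      simp only [mul_pow, monomial_eq, Finsupp.prod, map_prod, map_pow, Finset.prod_mul_distrib]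
    rw [this, algebraMap_eq, C_mul_monomial, coeff_monomial, coeff_monomial]
    split_ifs with h
    · rw [h]
    · simp
  | add p q hp hq => rw [map_add, coeff_add, hp, hq, coeff_add, add_mul]

theorem aeval_scale {B : Type*} [CommRing B] [Algebra ℂ B] {w : σ → ℕ} {P : MvPolynomial σ ℂ}
    {n : ℕ} (h : P.IsWeightedHomogeneous w n) (t : B) (x : σ → B) :
    aeval (fun j => t ^ w j * x j) P = t ^ n * aeval x P := by
  rw [P.as_sum, map_sum, map_sum, Finset.mul_sum]
  refine Finset.sum_congr rfl fun d hd => ?_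
  have hw := h (mem_support_iff.1 hd)
  rw [aeval_monomial, aeval_monomial]
  have : (d.prod fun j k => (t ^ w j * x j) ^ k) = t ^ n * d.prod fun j k => x j ^ k := by
    simp only [mul_pow, Finsupp.prod_mul]
    congr 1
    rw [← hw, Finsupp.weight_apply, Finsupp.prod, Finsupp.sum, ← Finset.prod_pow_eq_pow_sum]
    refine Finset.prod_congr rfl fun j _ => ?_
    rw [← pow_mul, smul_eq_mul, mul_comm]
  rw [this]; ring

theorem natDegree_aeval_le {R : Type*} [CommRing R] [Algebra ℂ R] {w : σ → ℕ}
    {P : MvPolynomial σ ℂ} {n : ℕ} (h : P.IsWeightedHomogeneous w n) (x : σ → Polynomial R)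
    (hx : ∀ j, (x j).natDegree ≤ w j) : (aeval x P).natDegree ≤ n := by
  rw [P.as_sum, map_sum]
  refine Polynomial.natDegree_sum_le_of_forall_le _ _ fun d hd => ?_
  have hw := h (mem_support_iff.1 hd)
  rw [aeval_monomial, IsScalarTower.algebraMap_apply ℂ R (Polynomial R),
    Polynomial.algebraMap_eq]
  refine (Polynomial.natDegree_C_mul_le _ _).trans ?_
  refine (Polynomial.natDegree_prod_le _ _).trans ?_
  rw [← hw, Finsupp.weight_apply, Finsupp.sum]
  refine Finset.sum_le_sum fun j _ => ?_
  refine Polynomial.natDegree_pow_le.trans ?_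
  rw [smul_eq_mul]
  exact Nat.mul_le_mul_left _ (hx j)

theorem coeff_aeval_scale (w : σ → ℕ) (P : MvPolynomial σ ℂ) (c : σ → ℂ) (k : ℕ) :
    (aeval (fun j => Polynomial.C (c j) * Polynomial.X ^ w j) P : Polynomial ℂ).coeff k =
      eval c (weightedHomogeneousComponent w k P) := by
  classical
  induction P using MvPolynomial.induction_on' with
  | monomial e a =>
    rw [aeval_monomial]
    have : (e.prod fun j m => (Polynomial.C (c j) * Polynomial.X ^ w j : Polynomial ℂ) ^ m) =
        Polynomial.C (e.prod fun j m => c j ^ m) * Polynomial.X ^ (Finsupp.weight w e) := by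
      simp only [mul_pow, Finsupp.prod_mul]
      congr 1
      · simp [Finsupp.prod]
      · rw [Finsupp.weight_apply, Finsupp.prod, Finsupp.sum, ← Finset.prod_pow_eq_pow_sum]
        refine Finset.prod_congr rfl fun j _ => ?_
        rw [← pow_mul, smul_eq_mul, mul_comm]
    rw [this, Polynomial.algebraMap_eq, ← mul_assoc, ← Polynomial.C_mul,
      Polynomial.coeff_C_mul_X_pow]
    have hm : (monomial e a).IsWeightedHomogeneous w (Finsupp.weight w e) :=
      isWeightedHomogeneous_monomial _ _ _ rfl
    split_ifs with h
    · rw [h, hm.weightedHomogeneousComponent_same, eval_monomial]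
    · rw [hm.weightedHomogeneousComponent_ne k h]; simp
  | add p q hp hq => rw [map_add, Polynomial.coeff_add, hp, hq, map_add, map_add]

end Gradings

/-- The weight on the coordinates taking the value `ω i` on the `i`-th form. -/
def blockWeight (ω : Fin 3 → ℕ) : Idx ![2, 2, 3] → ℕ := fun j => ω j.1

theorem sub₂_smul {B : Type*} [CommRing B] (α β γ δ s : B) (q : Fin 3 → B) :
    sub₂ α β γ δ (s • q) = s • sub₂ α β γ δ q := by
  ext i; fin_cases i <;> simp [sub₂] <;> ring

theorem sub₃_smul {B : Type*} [CommRing B] (α β γ δ s : B) (q : Fin 4 → B) :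
    sub₃ α β γ δ (s • q) = s • sub₃ α β γ δ q := by
  ext i; fin_cases i <;> simp [sub₃] <;> ring

theorem point_scale {B : Type*} [CommRing B] (ω : Fin 3 → ℕ) (t : B) (u v : Fin 3 → B)
    (f : Fin 4 → B) :
    (fun j => t ^ blockWeight ω j * point u v f j) =
      point (t ^ ω 0 • u) (t ^ ω 1 • v) (t ^ ω 2 • f) := by
  ext ⟨i, k⟩; fin_cases i <;> rfl

theorem component_mem {P : Poly} (hP : P ∈ Inv) (ω : Fin 3 → ℕ) (k : ℕ) :
    weightedHomogeneousComponent (blockWeight ω) k P ∈ Inv := by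
  rw [mem_inv_iff] at hP ⊢
  intro α β γ δ h u v f
  rw [← coeff_aeval_scale, ← coeff_aeval_scale]
  refine congrArg (fun p : Polynomial ℂ => p.coeff k) (Polynomial.funext fun t => ?_)
  have key : ∀ c : Idx ![2, 2, 3] → ℂ, Polynomial.eval t (aeval (fun j =>
      Polynomial.C (c j) * Polynomial.X ^ blockWeight ω j) P) =
      eval (fun j => t ^ blockWeight ω j * c j) P := by
    intro c
    rw [← Polynomial.coe_aeval_eq_eval, comp_aeval_apply, eval_eq_aeval]
    refine congrArg (fun x => aeval x P) (funext fun j => ?_)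
    rw [map_mul, Polynomial.aeval_C, map_pow, Polynomial.aeval_X]
    exact mul_comm _ _
  rw [key, key, point_scale, point_scale, ← sub₂_smul, ← sub₂_smul, ← sub₃_smul, hP _ _ _ _ h]

/-! ### Restriction to the cubics `t x³ + x² y` -/

/-- The polynomial functions of two binary quadratics. -/
abbrev Quad : Type := MvPolynomial (Fin 2 × Fin 3) ℂ

/-- The pair of quadratics with the given coefficient vectors. -/
def pair {B : Type*} (u v : Fin 3 → B) : Fin 2 × Fin 3 → B := fun j => ![u, v] j.1 j.2

theorem eq_pair {B : Type*} (c : Fin 2 × Fin 3 → B) :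
    c = pair (fun k => c (0, k)) (fun k => c (1, k)) := by
  ext ⟨i, k⟩; fin_cases i <;> rfl

/-- The generic first quadratic. -/
noncomputable def uvar : Fin 3 → Quad := fun k => X (0, k)

/-- The generic second quadratic. -/
noncomputable def vvar : Fin 3 → Quad := fun k => X (1, k)

theorem aeval_point_comp {B B' : Type*} [CommRing B] [Algebra ℂ B] [CommRing B'] [Algebra ℂ B']
    (φ : B →ₐ[ℂ] B') (u v : Fin 3 → B) (f : Fin 4 → B) (P : Poly) :
    φ (aeval (point u v f) P) =
      aeval (point (fun k => φ (u k)) (fun k => φ (v k)) (fun k => φ (f k))) P := by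
  rw [comp_aeval_apply]
  exact congrArg (fun x => aeval x P) (map_point φ.toRingHom u v f)

/-- Restriction of a polynomial function to the cubics `t x³ + x² y`. -/
noncomputable def slice : Poly →ₐ[ℂ] Polynomial Quad :=
  aeval (point (fun k => Polynomial.C (uvar k)) (fun k => Polynomial.C (vvar k))
    ![Polynomial.X, 1, 0, 0])

/-- Restriction to the cubics `t x³ + x² y`, at fixed quadratics. -/
noncomputable def sliceAt (u v : Fin 3 → ℂ) : Poly →ₐ[ℂ] Polynomial ℂ :=
  aeval (point (fun k => Polynomial.C (u k)) (fun k => Polynomial.C (v k))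
    ![Polynomial.X, 1, 0, 0])

theorem eval_sliceAt (u v : Fin 3 → ℂ) (P : Poly) (t : ℂ) :
    (sliceAt u v P).eval t = eval (point u v ![t, 1, 0, 0]) P := by
  rw [← Polynomial.coe_aeval_eq_eval, sliceAt, aeval_point_comp, eval_eq_aeval]
  refine congrArg (fun x => aeval x P) ?_
  congr 1
  · ext k; simp
  · ext k; simp
  · ext k; fin_cases k <;> simp

theorem coeff_sliceAt (u v : Fin 3 → ℂ) (P : Poly) (n : ℕ) :
    (sliceAt u v P).coeff n = eval (pair u v) ((slice P).coeff n) := by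
  have : sliceAt u v P = Polynomial.mapAlgHom (aeval (pair u v) : Quad →ₐ[ℂ] ℂ) (slice P) := by
    rw [slice, aeval_point_comp, sliceAt]
    refine congrArg (fun x => aeval x P) ?_
    congr 1
    · ext1 k; simp [uvar, pair]
    · ext1 k; simp [vvar, pair]
    · ext1 k; fin_cases k <;> simp
  rw [this, eval_eq_aeval]
  simp

theorem natDegree_sliceAt_le (u v : Fin 3 → ℂ) {P : Poly} {n : ℕ} (h : (slice P).natDegree ≤ n) :
    (sliceAt u v P).natDegree ≤ n := by
  rw [Polynomial.natDegree_le_iff_coeff_eq_zero] at h ⊢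
  intro N hN
  rw [coeff_sliceAt, h N hN, map_zero]

/-- Homogeneity of degree `k` in the coefficients of the cubic. -/
abbrev CubicHom (P : Poly) (k : ℕ) : Prop :=
  P.IsWeightedHomogeneous (blockWeight ![0, 0, 1]) k

theorem natDegree_slice_le {P : Poly} {k : ℕ} (h : CubicHom P k) : (slice P).natDegree ≤ k := by
  refine natDegree_aeval_le h _ ?_
  rintro ⟨i, j⟩
  fin_cases i
  · exact (Polynomial.natDegree_C _).le
  · exact (Polynomial.natDegree_C _).le
  · change Polynomial.natDegree ((![Polynomial.X, 1, 0, 0] : Fin 4 → Polynomial Quad) j) ≤ 1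
    change Fin 4 at j
    fin_cases j <;> simp

theorem eval_congr_cubic {u v : Fin 3 → ℂ} {f g : Fin 4 → ℂ} (h : f = g) (P : Poly) :
    eval (point u v f) P = eval (point u v g) P := by
  rw [h]

theorem eval_smul_cubic {P : Poly} {k : ℕ} (h : CubicHom P k) (s : ℂ) (u v : Fin 3 → ℂ)
    (f : Fin 4 → ℂ) : eval (point u v (s • f)) P = s ^ k * eval (point u v f) P := by
  have := aeval_scale h s (point u v f)
  rw [point_scale] at this
  rw [eval_eq_aeval, eval_eq_aeval, ← this]
  simp

theorem coeff_comp_X_add_C {p : Polynomial ℂ} {n : ℕ} (h : p.natDegree ≤ n) (s : ℂ) :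
    (p.comp (Polynomial.X + Polynomial.C s)).coeff n = p.coeff n := by
  rcases h.eq_or_lt with h | h
  · rw [← h]
    exact Polynomial.coeff_taylor_natDegree (r := s) (f := p)
  · rw [Polynomial.coeff_eq_zero_of_natDegree_lt h, Polynomial.coeff_eq_zero_of_natDegree_lt]
    rw [Polynomial.natDegree_comp, Polynomial.natDegree_X_add_C, mul_one]
    exact h

/-- The top coefficient of the restriction of an invariant is invariant under
`y ↦ y + s x`. -/
theorem eval_shift_coeff {P : Poly} (hP : P ∈ Inv) {n : ℕ} (h : (slice P).natDegree ≤ n)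
    (s : ℂ) (u v : Fin 3 → ℂ) :
    eval (pair (sub₂ 1 0 s 1 u) (sub₂ 1 0 s 1 v)) ((slice P).coeff n) =
      eval (pair u v) ((slice P).coeff n) := by
  rw [← coeff_sliceAt, ← coeff_sliceAt, ← coeff_comp_X_add_C (natDegree_sliceAt_le _ _ h) s]
  refine congrArg (fun p : Polynomial ℂ => p.coeff n) (Polynomial.funext fun t => ?_)
  rw [Polynomial.eval_comp, eval_sliceAt, eval_sliceAt,
    ← mem_inv_iff.1 hP 1 0 s 1 (by ring) u v ![t, 1, 0, 0]]
  have : sub₃ 1 0 s 1 ![t, 1, 0, 0] = ![t + s, 1, 0, 0] := by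
    ext i; fin_cases i <;> simp [sub₃]
  rw [this]
  simp

theorem two_pow_eval_coeff {P : Poly} (hP : P ∈ Inv) {k : ℕ} (h : CubicHom P k) (n : ℕ)
    (u v : Fin 3 → ℂ) :
    2 ^ (k + 2 * n) * eval (pair (sub₂ 2 0 0 2⁻¹ u) (sub₂ 2 0 0 2⁻¹ v)) ((slice P).coeff n) =
      eval (pair u v) ((slice P).coeff n) := by
  have key : sliceAt u v P = Polynomial.C (2 ^ k) *
      (sliceAt (sub₂ 2 0 0 2⁻¹ u) (sub₂ 2 0 0 2⁻¹ v) P).comp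
        (Polynomial.C 4 * Polynomial.X) := by
    refine Polynomial.funext fun t => ?_
    rw [Polynomial.eval_mul, Polynomial.eval_comp, eval_sliceAt, eval_sliceAt,
      ← mem_inv_iff.1 hP 2 0 0 2⁻¹ (by norm_num) u v ![t, 1, 0, 0]]
    have : sub₃ (2 : ℂ) 0 0 2⁻¹ ![t, 1, 0, 0] = (2 : ℂ) • ![4 * t, 1, 0, 0] := by
      ext i; fin_cases i <;> simp [sub₃] <;> ring
    rw [this, eval_smul_cubic h]
    simp
  rw [← coeff_sliceAt, ← coeff_sliceAt, key, Polynomial.coeff_C_mul,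
    Polynomial.comp_C_mul_X_coeff, pow_add, pow_mul]
  norm_num
  ring

theorem weight_coeff_slice {P : Poly} (hP : P ∈ Inv) {k : ℕ} (h : CubicHom P k) (n : ℕ)
    {d : Fin 2 × Fin 3 →₀ ℕ} (hd : d ∈ ((slice P).coeff n).support) :
    k + 2 * n + 2 * (d (0, 0) + d (1, 0)) = 2 * (d (0, 2) + d (1, 2)) := by
  set H := (slice P).coeff n with hH
  let a : Fin 2 × Fin 3 → ℂ := fun j => ![4, 1, 4⁻¹] j.2
  have key : (C (2 ^ (k + 2 * n)) * aeval (fun j => C (a j) * X j : _ → Quad) H) = H := by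
    apply MvPolynomial.funext
    intro x
    rw [eq_pair x, ← two_pow_eval_coeff hP h n, map_mul, eval_C, eval_eq_aeval, comp_aeval_apply,
      eval_eq_aeval]
    refine congrArg (fun y => 2 ^ (k + 2 * n) * aeval y H) ?_
    ext ⟨i, j⟩
    fin_cases i <;> fin_cases j <;> simp [a, pair, sub₂] <;> norm_num <;> ring
  have h2 := congrArg (coeff d) key
  rw [coeff_C_mul, coeff_aeval_C_mul_X] at h2
  have h3 : (2 : ℂ) ^ (k + 2 * n) * (d.prod fun j e => a j ^ e) = 1 := by
    have := mem_support_iff.1 hd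
    field_simp at h2
    linear_combination h2
  rw [Finsupp.prod_fintype _ _ (by simp), Fintype.prod_prod_type] at h3
  simp only [Fin.prod_univ_two, Fin.prod_univ_three, a] at h3
  simp only [Matrix.cons_val_zero, Matrix.cons_val_one, Matrix.cons_val, one_pow, mul_one,
    inv_pow] at h3
  have h4 : (2 : ℂ) ^ (k + 2 * n + 2 * (d (0, 0) + d (1, 0))) =
      2 ^ (2 * (d (0, 2) + d (1, 2))) := by
    have e : (4 : ℂ) = 2 ^ 2 := by norm_num
    rw [e] at h3
    field_simp at h3
    simp only [pow_add, pow_mul, mul_add] at h3 ⊢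
    linear_combination h3
  have h5 : (2 : ℕ) ^ (k + 2 * n + 2 * (d (0, 0) + d (1, 0))) =
      2 ^ (2 * (d (0, 2) + d (1, 2))) := by exact_mod_cast h4
  exact Nat.pow_right_injective le_rfl h5

/-- Evaluation at fixed quadratics and a polynomial family of cubics. -/
noncomputable def family (u v : Fin 3 → ℂ) (g : Fin 4 → Polynomial ℂ) : Poly →ₐ[ℂ] Polynomial ℂ :=
  aeval (point (fun k => Polynomial.C (u k)) (fun k => Polynomial.C (v k)) g)

theorem eval_family (u v : Fin 3 → ℂ) (g : Fin 4 → Polynomial ℂ) (P : Poly) (t : ℂ) :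
    (family u v g P).eval t = eval (point u v fun k => (g k).eval t) P := by
  rw [← Polynomial.coe_aeval_eq_eval, family, aeval_point_comp, eval_eq_aeval]
  simp

theorem reflect_sliceAt {P : Poly} {k : ℕ} (h : CubicHom P k) (u v : Fin 3 → ℂ) :
    Polynomial.reflect k (sliceAt u v P) = family u v ![1, Polynomial.X, 0, 0] P := by
  have : Polynomial.X * Polynomial.reflect k (sliceAt u v P) =
      Polynomial.X * family u v ![1, Polynomial.X, 0, 0] P := by
    refine Polynomial.funext fun t => ?_
    rw [Polynomial.eval_mul, Polynomial.eval_mul, Polynomial.eval_X]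
    rcases eq_or_ne t 0 with rfl | ht
    · simp
    congr 1
    have hx : t⁻¹ ≠ 0 := inv_ne_zero ht
    let _ := invertibleOfNonzero hx
    have e := Polynomial.eval₂_reflect_mul_pow (RingHom.id ℂ) t⁻¹ k (sliceAt u v P)
      (natDegree_sliceAt_le u v (natDegree_slice_le h))
    rw [invOf_eq_inv, inv_inv, Polynomial.eval₂_id, Polynomial.eval₂_id, eval_sliceAt] at e
    have e2 : (![t⁻¹, 1, 0, 0] : Fin 4 → ℂ) = t⁻¹ • ![1, t, 0, 0] := by
      ext i; fin_cases i <;> simp [ht]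
    rw [e2, eval_smul_cubic h, mul_comm] at e
    rw [mul_left_cancel₀ (pow_ne_zero k hx) e, eval_family]
    refine eval_congr_cubic ?_ P
    ext i; fin_cases i <;> simp
  exact mul_left_cancel₀ Polynomial.X_ne_zero this

theorem coeff_slice_pred {P : Poly} (hP : P ∈ Inv) {k : ℕ} (h : CubicHom P (k + 1))
    (h0 : (slice P).coeff (k + 1) = 0) : (slice P).coeff k = 0 := by
  have htop : ∀ u v, eval (point u v ![1, 0, 0, 0]) P = 0 := by
    intro u v
    have e : (Polynomial.reflect (k + 1) (sliceAt u v P)).coeff 0 = 0 := by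
      rw [Polynomial.coeff_reflect, Polynomial.revAt_le (Nat.zero_le _), Nat.sub_zero,
        coeff_sliceAt, h0, map_zero]
    rw [reflect_sliceAt h, Polynomial.coeff_zero_eq_eval_zero, eval_family] at e
    refine (eval_congr_cubic ?_ P).trans e
    ext i; fin_cases i <;> simp
  apply MvPolynomial.funext
  intro x
  rw [eq_pair x, map_zero, ← coeff_sliceAt]
  generalize (fun k => x (0, k)) = u
  generalize (fun k => x (1, k)) = v
  have hcube : family u v ![1, 3 * Polynomial.X, 3 * Polynomial.X ^ 2, Polynomial.X ^ 3] P =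
      0 := by
    refine Polynomial.funext fun r => ?_
    rw [eval_family, ← mem_inv_iff.1 hP 1 (-r) 0 1 (by ring)]
    have : sub₃ 1 (-r) 0 1 (fun k => Polynomial.eval r
        ((![1, 3 * Polynomial.X, 3 * Polynomial.X ^ 2, Polynomial.X ^ 3] :
          Fin 4 → Polynomial ℂ) k)) = ![1, 0, 0, 0] := by
      ext i; fin_cases i <;> simp [sub₃] <;> ring
    rw [this, htop]
    simp
  have hcomp : (family u v ![1, Polynomial.X, 0, 0] P).comp (Polynomial.C 3 * Polynomial.X) =
      family u v ![1, 3 * Polynomial.X, 0, 0] P := by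
    refine Polynomial.funext fun r => ?_
    rw [Polynomial.eval_comp, eval_family, eval_family]
    refine eval_congr_cubic ?_ P
    ext i; fin_cases i <;> simp
  have hmod : Polynomial.X ^ 2 ∣ family u v ![1, 3 * Polynomial.X, 0, 0] P -
      family u v ![1, 3 * Polynomial.X, 3 * Polynomial.X ^ 2, Polynomial.X ^ 3] P := by
    rw [← Ideal.mem_span_singleton, ← Ideal.Quotient.eq]
    let φ := Ideal.Quotient.mkₐ ℂ (Ideal.span {(Polynomial.X ^ 2 : Polynomial ℂ)})
    have hφ : φ (Polynomial.X ^ 2) = 0 := by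
      simp [φ]
    change φ _ = φ _
    rw [family, family, aeval_point_comp, aeval_point_comp]
    refine congrArg (fun f => aeval (point _ _ f) P) ?_
    ext i
    fin_cases i
    · rfl
    · rfl
    · simp [hφ, map_mul]
    · simp only [Fin.reduceFinMk, Matrix.cons_val, map_zero]
      rw [show (Polynomial.X ^ 3 : Polynomial ℂ) = Polynomial.X ^ 2 * Polynomial.X from
        pow_succ _ _, map_mul, hφ, zero_mul]
  rw [hcube, sub_zero, ← hcomp, Polynomial.X_pow_dvd_iff] at hmod
  have := hmod 1 (by norm_num)
  rw [Polynomial.comp_C_mul_X_coeff, ← reflect_sliceAt h, Polynomial.coeff_reflect,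
    Polynomial.revAt_le (by omega), Nat.add_sub_cancel] at this
  simpa using this

/-! ### Covariants of two quadratics -/

section KillVariable

variable {σ : Type*} [DecidableEq σ]

theorem X_dvd_sub_aeval_update (i : σ) (P : MvPolynomial σ ℂ) :
    X i ∣ P - aeval (Function.update X i 0 : σ → MvPolynomial σ ℂ) P := by
  rw [← Ideal.mem_span_singleton, ← Ideal.Quotient.eq]
  let φ := Ideal.Quotient.mkₐ ℂ (Ideal.span {(X i : MvPolynomial σ ℂ)})
  change φ P = φ _
  conv_lhs => rw [← aeval_X_left_apply P]
  rw [comp_aeval_apply, comp_aeval_apply]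
  refine congrArg (fun x => aeval x P) (funext fun j => ?_)
  rcases eq_or_ne j i with rfl | h
  · simp [φ]
  · simp [h]

theorem X_dvd_of_eval (i : σ) {P G : MvPolynomial σ ℂ} (hG : ∃ x, x i = 0 ∧ eval x G ≠ 0)
    (h : ∀ x, x i = 0 → eval x G ≠ 0 → eval x P = 0) : X i ∣ P := by
  have ev : ∀ (Q : MvPolynomial σ ℂ) (x : σ → ℂ),
      eval x (aeval (Function.update X i 0 : σ → MvPolynomial σ ℂ) Q) =
        eval (Function.update x i 0) Q := by
    intro Q x
    rw [eval_eq_aeval, comp_aeval_apply, eval_eq_aeval]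
    refine congrArg (fun x => aeval x Q) (funext fun j => ?_)
    rcases eq_or_ne j i with rfl | h
    · simp
    · simp [h]
  have hG' : aeval (Function.update X i 0 : σ → MvPolynomial σ ℂ) G ≠ 0 := by
    obtain ⟨x, hx, hx'⟩ := hG
    intro h0
    apply hx'
    have := ev G x
    have hu : Function.update x i 0 = x := by
      conv_lhs => rw [← hx]
      exact Function.update_eq_self i x
    rw [h0, map_zero, hu] at this
    exact this.symm
  have hz : aeval (Function.update X i 0 : σ → MvPolynomial σ ℂ) P *
      aeval (Function.update X i 0 : σ → MvPolynomial σ ℂ) G = 0 := by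
    apply MvPolynomial.funext
    intro x
    rw [map_mul, ev, ev, map_zero]
    by_cases h0 : eval (Function.update x i 0) G = 0
    · rw [h0, mul_zero]
    · rw [h _ (by simp) h0, zero_mul]
  have := X_dvd_sub_aeval_update i P
  rwa [(mul_eq_zero.1 hz).resolve_right hG', sub_zero] at this

end KillVariable

/-- The functions `A₁₁, A₁₂, A₂₂, c, c'` of two quadratics. -/
noncomputable def qfun : Fin 5 → Quad :=
  ![pairing uvar uvar, pairing uvar vvar, pairing vvar vvar, uvar 2, vvar 2]

/-- The function `b c' - b' c` of two quadratics. -/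
noncomputable def mfun : Quad := uvar 1 * vvar 2 - vvar 1 * uvar 2

theorem mfun_sq : mfun ^ 2 =
    aeval qfun (-(X 0 * X 4 ^ 2) + 2 * (X 1 * X 3 * X 4) - X 2 * X 3 ^ 2 :
      MvPolynomial (Fin 5) ℂ) := by
  simp only [map_add, map_sub, map_neg, map_mul, map_pow, map_ofNat, aeval_X]
  simp [mfun, qfun, pairing]
  ring

/-- The functions of the form `n₀(A, c, c') + m n₁(A, c, c')`. -/
noncomputable def covariants : Subalgebra ℂ Quad where
  carrier := {h | ∃ n₀ n₁ : MvPolynomial (Fin 5) ℂ, h = aeval qfun n₀ + mfun * aeval qfun n₁}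
  mul_mem' := by
    rintro _ _ ⟨p₀, p₁, rfl⟩ ⟨q₀, q₁, rfl⟩
    refine ⟨p₀ * q₀ + (-(X 0 * X 4 ^ 2) + 2 * (X 1 * X 3 * X 4) - X 2 * X 3 ^ 2) * (p₁ * q₁),
      p₀ * q₁ + p₁ * q₀, ?_⟩
    rw [map_add, map_mul _ (_ - _), ← mfun_sq]
    simp only [map_mul, map_add]
    ring
  add_mem' := by
    rintro _ _ ⟨p₀, p₁, rfl⟩ ⟨q₀, q₁, rfl⟩
    exact ⟨p₀ + q₀, p₁ + q₁, by simp only [map_add]; ring⟩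
  algebraMap_mem' r := ⟨C r, 0, by simp⟩

theorem qfun_mem (i : Fin 5) : qfun i ∈ covariants := ⟨X i, 0, by simp⟩

theorem mfun_mem : mfun ∈ covariants := ⟨0, 1, by simp⟩

theorem mem_covariants_of_mul {h : Quad} (hh : uvar 2 * h ∈ covariants) : h ∈ covariants := by
  obtain ⟨n₀, n₁, e⟩ := hh
  have key : ∀ x : Fin 5 → ℂ, x 3 = 0 → eval x (X 0 * X 4) ≠ 0 →
      eval x n₀ = 0 ∧ eval x n₁ = 0 := by
    intro x hx h0
    simp only [map_mul, eval_X, mul_ne_zero_iff] at h0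
    obtain ⟨b, hb⟩ := IsAlgClosed.exists_pow_nat_eq (-x 0) (n := 2) (by norm_num)
    have hb0 : b ≠ 0 := by
      rintro rfl
      apply h0.1
      rw [zero_pow two_ne_zero] at hb
      exact neg_eq_zero.1 hb.symm
    have hx4 := h0.2
    have main : ∀ ε : ℂ, ε ^ 2 = 1 → eval x n₀ + ε * b * x 4 * eval x n₁ = 0 := by
      intro ε hε
      have e' := congrArg (aeval (pair ![x 1 / (2 * x 4), ε * b, 0] ![x 2 / (4 * x 4), 0, x 4]))
        e
      have hq : (fun i => aeval (pair ![x 1 / (2 * x 4), ε * b, 0] ![x 2 / (4 * x 4), 0, x 4])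
          (qfun i)) = x := by
        ext i
        fin_cases i <;> simp [qfun, pairing, uvar, vvar, pair, hx]
        · linear_combination (-b ^ 2) * hε - hb
        · field_simp
        · field_simp; ring
      rw [map_add, map_mul, map_mul, comp_aeval_apply, comp_aeval_apply, hq] at e'
      rw [eval_eq_aeval, eval_eq_aeval]
      simp [uvar, vvar, mfun, pair] at e'
      exact e'.symm
    have h1 := main 1 (by norm_num)
    have h2 := main (-1) (by norm_num)
    have h3 : b * x 4 * eval x n₁ = 0 := by linear_combination (h1 - h2) / 2
    have h4 := (mul_eq_zero.1 h3).resolve_left (mul_ne_zero hb0 hx4)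
    exact ⟨by rw [h4] at h1; simpa using h1, h4⟩
  have hG : ∃ x : Fin 5 → ℂ, x 3 = 0 ∧ eval x (X 0 * X 4) ≠ 0 :=
    ⟨![1, 0, 0, 0, 1], by simp, by simp⟩
  obtain ⟨p₀, rfl⟩ := X_dvd_of_eval 3 hG fun x hx h0 => (key x hx h0).1
  obtain ⟨p₁, rfl⟩ := X_dvd_of_eval 3 hG fun x hx h0 => (key x hx h0).2
  refine ⟨p₀, p₁, ?_⟩
  have hc : uvar 2 ≠ 0 := X_ne_zero _
  apply mul_left_cancel₀ hc
  rw [e]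
  simp only [map_mul, aeval_X]
  simp only [qfun, Matrix.cons_val]
  ring

theorem mem_covariants_of_pow_mul {h : Quad} (N : ℕ) (hh : uvar 2 ^ N * h ∈ covariants) :
    h ∈ covariants := by
  induction N with
  | zero => simpa using hh
  | succ N ih =>
    rw [pow_succ', mul_assoc] at hh
    exact ih (mem_covariants_of_mul hh)

/-- A polynomial function of two quadratics invariant under `y ↦ y + s x` is a polynomial
in the `A`s, the trailing coefficients and `m`. -/
theorem mem_covariants_of_shift {h : Quad}
    (hh : ∀ (s : ℂ) (u v : Fin 3 → ℂ),
      eval (pair (sub₂ 1 0 s 1 u) (sub₂ 1 0 s 1 v)) h = eval (pair u v) h) :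
    h ∈ covariants := by
  have clear : ∀ P : Quad, ∃ N, ∃ e ∈ covariants, ∀ u v : Fin 3 → ℂ, u 2 ≠ 0 →
      u 2 ^ N * eval (pair (sub₂ 1 0 (-u 1 / (2 * u 2)) 1 u)
        (sub₂ 1 0 (-u 1 / (2 * u 2)) 1 v)) P = eval (pair u v) e := by
    intro P
    induction P using MvPolynomial.induction_on with
    | C r => exact ⟨0, C r, covariants.algebraMap_mem r, fun u v _ => by simp⟩
    | add p q hp hq =>
      obtain ⟨N, e, he, h⟩ := hp
      obtain ⟨N', e', he', h'⟩ := hq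
      refine ⟨N + N', qfun 3 ^ N' * e + qfun 3 ^ N * e', add_mem
        (mul_mem (pow_mem (qfun_mem 3) _) he) (mul_mem (pow_mem (qfun_mem 3) _) he'), ?_⟩
      intro u v hu
      have hq3 : eval (pair u v) (qfun 3) = u 2 := by simp [qfun, uvar, pair]
      simp only [map_add, map_mul, map_pow, hq3]
      linear_combination u 2 ^ N' * h u v hu + u 2 ^ N * h' u v hu
    | mul_X p j hp =>
      obtain ⟨N, e, he, h⟩ := hp
      suffices H : ∃ r ∈ covariants, ∀ u v : Fin 3 → ℂ, u 2 ≠ 0 →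
          u 2 ^ 2 * pair (sub₂ 1 0 (-u 1 / (2 * u 2)) 1 u)
            (sub₂ 1 0 (-u 1 / (2 * u 2)) 1 v) j = eval (pair u v) r by
        obtain ⟨r, hr, H⟩ := H
        refine ⟨N + 2, e * r, mul_mem he hr, fun u v hu => ?_⟩
        rw [map_mul, map_mul, ← h u v hu, ← H u v hu, eval_X]
        ring
      have q0 := qfun_mem 0
      have q1 := qfun_mem 1
      have q3 := qfun_mem 3
      have q4 := qfun_mem 4
      have cst : ∀ r : ℂ, (C r : Quad) ∈ covariants := fun r => covariants.algebraMap_mem r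
      obtain ⟨i, j⟩ := j
      fin_cases i <;> fin_cases j
      · refine ⟨C 4⁻¹ * (qfun 3 * qfun 0), mul_mem (cst _) (mul_mem q3 q0), fun u v hu => ?_⟩
        simp [qfun, uvar, pairing, pair, sub₂]
        field_simp
        ring
      · refine ⟨0, zero_mem _, fun u v hu => ?_⟩
        simp [pair, sub₂]
        field_simp
        ring_nf
        simp
      · refine ⟨qfun 3 ^ 3, pow_mem q3 _, fun u v hu => ?_⟩
        simp [qfun, uvar, pair, sub₂]
        ring
      · refine ⟨C 4⁻¹ * (2 * (qfun 3 * qfun 1) - qfun 4 * qfun 0),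
          mul_mem (cst _) (sub_mem (mul_mem (by exact_mod_cast cst 2) (mul_mem q3 q1))
            (mul_mem q4 q0)), fun u v hu => ?_⟩
        simp [qfun, uvar, vvar, pairing, pair, sub₂]
        field_simp
        ring
      · refine ⟨-(qfun 3 * mfun), neg_mem (mul_mem q3 mfun_mem), fun u v hu => ?_⟩
        simp [qfun, mfun, uvar, vvar, pair, sub₂]
        field_simp
        ring
      · refine ⟨qfun 3 ^ 2 * qfun 4, mul_mem (pow_mem q3 _) q4, fun u v hu => ?_⟩
        simp [qfun, uvar, vvar, pair, sub₂]
  obtain ⟨N, e, he, h'⟩ := clear h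
  apply mem_covariants_of_pow_mul (N + 1)
  have : uvar 2 ^ (N + 1) * h = qfun 3 * e := by
    apply MvPolynomial.funext
    intro x
    rw [eq_pair x]
    generalize (fun k => x (0, k)) = u
    generalize (fun k => x (1, k)) = v
    have hq3 : eval (pair u v) (qfun 3) = u 2 := by simp [qfun, uvar, pair]
    have hu2 : eval (pair u v) (uvar 2) = u 2 := by simp [uvar, pair]
    rw [map_mul, map_mul, map_pow, hq3, hu2]
    by_cases hu : u 2 = 0
    · rw [hu]; simp
    · rw [← h' u v hu, hh]; ring
  rw [this]
  exact mul_mem (qfun_mem 3) he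

/-! #### Weights -/

/-- The weight of the coefficients of two quadratics under the torus. -/
def torusWeight : Fin 2 × Fin 3 → ℤ := fun j => ![-1, 0, 1] j.2

/-- The span of the products of `A`s, `c`, `c'`, `m` of weight `N`, linear in `m`. -/
noncomputable def covariantSpan (N : ℕ) : Submodule ℂ Quad :=
  Submodule.span ℂ {h | ∃ e : Fin 5 →₀ ℕ, ∃ ε : ℕ, ε ≤ 1 ∧ e 3 + e 4 + ε = N ∧
    h = aeval qfun (monomial e (1 : ℂ)) * mfun ^ ε}

theorem qfun_weight (i : Fin 5) :
    (qfun i).IsWeightedHomogeneous torusWeight ((![0, 0, 0, 1, 1] : Fin 5 → ℤ) i) := by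
  have hX : ∀ j, (X j : Quad).IsWeightedHomogeneous torusWeight (torusWeight j) :=
    fun j => isWeightedHomogeneous_X ℂ _ j
  have h2 : (2 : Quad).IsWeightedHomogeneous torusWeight 0 :=
    isWeightedHomogeneous_C torusWeight (2 : ℂ)
  have hp : ∀ i j : Fin 2, (pairing (fun k => (X (i, k) : Quad)) fun k =>
      X (j, k)).IsWeightedHomogeneous torusWeight 0 := by
    intro i j
    have e0 := (h2.mul (hX (i, 0))).mul (hX (j, 2))
    have e1 := (hX (i, 1)).mul (hX (j, 1))
    have e2 := (h2.mul (hX (i, 2))).mul (hX (j, 0))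
    simp only [torusWeight] at e0 e1 e2
    exact ((weightedHomogeneousSubmodule ℂ torusWeight (0 : ℤ)).add_mem
      (Submodule.sub_mem _ e0 e1) e2)
  fin_cases i
  · exact hp 0 0
  · exact hp 0 1
  · exact hp 1 1
  · exact hX (0, 2)
  · exact hX (1, 2)

theorem mfun_weight : mfun.IsWeightedHomogeneous torusWeight (1 : ℤ) := by
  have hX : ∀ j, (X j : Quad).IsWeightedHomogeneous torusWeight (torusWeight j) :=
    fun j => isWeightedHomogeneous_X ℂ _ j
  exact Submodule.sub_mem (weightedHomogeneousSubmodule ℂ torusWeight (1 : ℤ))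
    ((hX (0, 1)).mul (hX (1, 2))) ((hX (1, 1)).mul (hX (0, 2)))

theorem weight_product (e : Fin 5 →₀ ℕ) (ε : ℕ) :
    (aeval qfun (monomial e (1 : ℂ)) * mfun ^ ε).IsWeightedHomogeneous torusWeight
      ((e 3 + e 4 + ε : ℕ) : ℤ) := by
  have h1 := IsWeightedHomogeneous.prod Finset.univ (fun i => qfun i ^ e i)
    (fun i => e i • (![0, 0, 0, 1, 1] : Fin 5 → ℤ) i) fun i _ => (qfun_weight i).pow (e i)
  have h2 := mfun_weight.pow ε
  convert h1.mul h2 using 1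
  · rw [aeval_monomial, map_one, one_mul, Finsupp.prod_fintype _ _ (by simp)]
  · simp [Fin.sum_univ_five]

theorem mem_covariantSpan {h : Quad} (hh : h ∈ covariants) {N : ℕ}
    (hN : ∀ d ∈ h.support, N + (d (0, 0) + d (1, 0)) = d (0, 2) + d (1, 2)) :
    h ∈ covariantSpan N := by
  have hw : h.IsWeightedHomogeneous torusWeight (N : ℤ) := by
    intro d hd
    have := hN d (mem_support_iff.2 hd)
    rw [Finsupp.weight_apply, Finsupp.sum_fintype _ _ (by simp), Fintype.sum_prod_type]
    simp only [Fin.sum_univ_two, Fin.sum_univ_three, torusWeight]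
    simp
    omega
  have comp : ∀ (ε : ℕ), ε ≤ 1 → ∀ n : MvPolynomial (Fin 5) ℂ,
      weightedHomogeneousComponent torusWeight (N : ℤ) (aeval qfun n * mfun ^ ε) ∈
        covariantSpan N := by
    intro ε hε n
    induction n using MvPolynomial.induction_on' with
    | monomial e c =>
      have : aeval qfun (monomial e c) * mfun ^ ε =
          c • (aeval qfun (monomial e (1 : ℂ)) * mfun ^ ε) := by
        have hc : monomial e c = c • monomial e (1 : ℂ) := by
          rw [smul_monomial, smul_eq_mul, mul_one]
        rw [hc, map_smul, smul_mul_assoc]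
      rw [this, map_smul]
      refine Submodule.smul_mem _ _ ?_
      by_cases h : e 3 + e 4 + ε = N
      · have hp := weight_product e ε
        rw [h] at hp
        rw [hp.weightedHomogeneousComponent_same]
        exact Submodule.subset_span ⟨e, ε, hε, h, rfl⟩
      · rw [(weight_product e ε).weightedHomogeneousComponent_ne]
        · exact zero_mem _
        · intro h'; apply h; exact_mod_cast h'.symm
    | add p q hp hq => rw [map_add, add_mul, map_add]; exact add_mem hp hq
  obtain ⟨n₀, n₁, e⟩ := hh
  rw [← hw.weightedHomogeneousComponent_same, e, map_add]
  refine add_mem ?_ ?_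
  · simpa using comp 0 (by norm_num) n₀
  · simpa [mul_comm] using comp 1 le_rfl n₁

/-! ### Homogeneity of the basic invariants -/

theorem weight_eq_of_scale {σ : Type*} {w : σ → ℕ} {P : MvPolynomial σ ℂ} {m n : ℕ}
    (h : C (2 ^ m) * aeval (fun j => C (2 ^ w j) * X j : σ → MvPolynomial σ ℂ) P =
      C (2 ^ n) * P) {d : σ →₀ ℕ} (hd : coeff d P ≠ 0) : m + Finsupp.weight w d = n := by
  have h2 := congrArg (coeff d) h
  rw [coeff_C_mul, coeff_C_mul, coeff_aeval_C_mul_X, mul_left_comm, mul_comm (2 ^ n)] at h2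
  have h3 := mul_left_cancel₀ hd h2
  have h4 : (d.prod fun j e => ((2 : ℂ) ^ w j) ^ e) = 2 ^ Finsupp.weight w d := by
    rw [Finsupp.weight_apply, Finsupp.sum, ← Finset.prod_pow_eq_pow_sum, Finsupp.prod]
    refine Finset.prod_congr rfl fun j _ => ?_
    rw [← pow_mul, smul_eq_mul, mul_comm]
  rw [h4, ← pow_add] at h3
  exact Nat.pow_right_injective le_rfl (by exact_mod_cast h3)

theorem eval_aeval_scale {σ : Type*} (w : σ → ℕ) (P : MvPolynomial σ ℂ) (x : σ → ℂ) :
    eval x (aeval (fun j => C (2 ^ w j) * X j : σ → MvPolynomial σ ℂ) P) =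
      eval (fun j => 2 ^ w j * x j) P := by
  rw [eval_eq_aeval, comp_aeval_apply, ← eval_eq_aeval]
  refine congrArg (fun y => eval y P) (_root_.funext fun j => ?_)
  simp

theorem isWeightedHomogeneous_of_scale {σ : Type*} {w : σ → ℕ} {P : MvPolynomial σ ℂ} {n : ℕ}
    (h : ∀ x : σ → ℂ, eval (fun j => 2 ^ w j * x j) P = 2 ^ n * eval x P) :
    P.IsWeightedHomogeneous w n := by
  intro d hd
  rw [← weight_eq_of_scale (m := 0) (n := n) _ hd, zero_add]
  apply MvPolynomial.funext
  intro x
  rw [map_mul, map_mul, eval_aeval_scale, h, eval_C, eval_C, pow_zero, one_mul]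

/-- The multidegrees of the basic invariants. -/
def basicDegree : Fin 18 → Fin 3 → ℕ :=
  ![![2, 0, 0], ![1, 1, 0], ![0, 2, 0], ![1, 0, 2], ![0, 1, 2], ![0, 0, 4], ![1, 1, 2],
    ![3, 0, 2], ![2, 1, 2], ![1, 2, 2], ![0, 3, 2], ![3, 1, 2], ![2, 2, 2], ![1, 3, 2],
    ![3, 0, 4], ![2, 1, 4], ![1, 2, 4], ![0, 3, 4]]

theorem basicVal_smul {B : Type*} [CommRing B] (r s t : B) (u v : Fin 3 → B) (f : Fin 4 → B)
    (i : Fin 18) :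
    basicVal (r • u) (s • v) (t • f) i =
      r ^ basicDegree i 0 * s ^ basicDegree i 1 * t ^ basicDegree i 2 * basicVal u v f i := by
  fin_cases i <;> simp [basicVal, basicDegree, pairing, hess, cross, jac, lin, bil] <;> ring

theorem basic_isWeightedHomogeneous (ω : Fin 3 → ℕ) (i : Fin 18) :
    (basic i).IsWeightedHomogeneous (blockWeight ω)
      (ω 0 * basicDegree i 0 + ω 1 * basicDegree i 1 + ω 2 * basicDegree i 2) := by
  refine isWeightedHomogeneous_of_scale fun x => ?_
  rw [eq_point x, point_scale, eval_basic, eval_basic, basicVal_smul, pow_add, pow_add, pow_mul,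
    pow_mul, pow_mul]

theorem basic_cubicHom (i : Fin 18) : CubicHom (basic i) (basicDegree i 2) := by
  have := basic_isWeightedHomogeneous ![0, 0, 1] i
  simpa using this

/-! ### Realizing leading coefficients -/

/-- The subalgebra generated by the basic invariants. -/
noncomputable def basicAlg : Subalgebra ℂ Poly := Algebra.adjoin ℂ (Set.range basic)

theorem basic_mem_basicAlg (i : Fin 18) : basic i ∈ basicAlg :=
  Algebra.subset_adjoin ⟨i, rfl⟩

theorem basicAlg_le : basicAlg ≤ Inv :=
  Algebra.adjoin_le (by rintro _ ⟨i, rfl⟩; exact basic_mem i)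

/-- The leading coefficients, in degree `n`, of the restrictions of elements of `basicAlg` of
degree `k` in the cubic. -/
noncomputable def realized (k n : ℕ) : Submodule ℂ Quad where
  carrier := {h | ∃ a ∈ basicAlg, CubicHom a k ∧ (slice a).natDegree ≤ n ∧ (slice a).coeff n = h}
  zero_mem' := ⟨0, zero_mem _, isWeightedHomogeneous_zero _ _ _, by simp, by simp⟩
  add_mem' := by
    rintro _ _ ⟨a, ha, h1, h2, rfl⟩ ⟨b, hb, h3, h4, rfl⟩
    refine ⟨a + b, add_mem ha hb, h1.add h3, ?_, by simp⟩
    rw [map_add]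
    exact Polynomial.natDegree_add_le_of_degree_le h2 h4
  smul_mem' := by
    rintro r _ ⟨a, ha, h1, h2, rfl⟩
    refine ⟨r • a, Subalgebra.smul_mem _ ha r,
      Submodule.smul_mem (weightedHomogeneousSubmodule ℂ _ k) r h1, ?_, by simp⟩
    rw [map_smul]
    exact (Polynomial.natDegree_smul_le _ _).trans h2

theorem realized_mul {k n k' n' : ℕ} {h h' : Quad} (hh : h ∈ realized k n)
    (hh' : h' ∈ realized k' n') : h * h' ∈ realized (k + k') (n + n') := by
  obtain ⟨a, ha, h1, h2, rfl⟩ := hh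
  obtain ⟨b, hb, h3, h4, rfl⟩ := hh'
  refine ⟨a * b, mul_mem ha hb, h1.mul h3, ?_, ?_⟩
  · rw [map_mul]
    exact Polynomial.natDegree_mul_le_of_le h2 h4
  · rw [map_mul]
    exact Polynomial.coeff_mul_add_eq_of_natDegree_le h2 h4

theorem realized_one : (1 : Quad) ∈ realized 0 0 :=
  ⟨1, one_mem _, isWeightedHomogeneous_one _ _, by simp, by simp⟩

theorem realized_pow {k n : ℕ} {h : Quad} (hh : h ∈ realized k n) (e : ℕ) :
    h ^ e ∈ realized (e * k) (e * n) := by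
  induction e with
  | zero => simpa using realized_one
  | succ e ih => rw [pow_succ, Nat.succ_mul, Nat.succ_mul]; exact realized_mul ih hh

theorem mem_realized {k n : ℕ} {h : Quad} {a : Poly} (ha : a ∈ basicAlg) (hk : CubicHom a k)
    (r : ℂ) (hr : r ≠ 0) (p : Polynomial Quad) (hp : p.natDegree ≤ n)
    (hn : p.coeff n = C r * h) (e : slice a = p) : h ∈ realized k n := by
  have : h = r⁻¹ • (C r * h) := by
    rw [C_mul', smul_smul, inv_mul_cancel₀ hr, one_smul]
  rw [this]
  exact Submodule.smul_mem _ _ ⟨a, ha, hk, e ▸ hp, e ▸ hn⟩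

theorem slice_basic (i : Fin 18) :
    slice (basic i) = basicVal (fun k => Polynomial.C (uvar k)) (fun k => Polynomial.C (vvar k))
      ![Polynomial.X, 1, 0, 0] i :=
  aeval_basic _ _ _ i

theorem qfun_mem_realized (i : Fin 5) (hi : i.1 < 3) : qfun i ∈ realized 0 0 := by
  have : ∀ j : Fin 18, basicDegree j 2 = 0 → slice (basic j) = Polynomial.C (qfun i) →
      qfun i ∈ realized 0 0 := fun j hj e =>
    mem_realized (basic_mem_basicAlg j) (hj ▸ basic_cubicHom j) 1 one_ne_zero _ (by simp)
      (by simp) e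
  fin_cases i
  · exact this 0 rfl (by rw [slice_basic]; simp [basicVal, qfun, pairing, map_ofNat Polynomial.C])
  · exact this 1 rfl (by rw [slice_basic]; simp [basicVal, qfun, pairing, map_ofNat Polynomial.C])
  · exact this 2 rfl (by rw [slice_basic]; simp [basicVal, qfun, pairing, map_ofNat Polynomial.C])
  · simp at hi
  · simp at hi

theorem letter_mem_realized {h : Quad} (j : Fin 18) (hj : basicDegree j 2 = 2)
    (e : slice (basic j) = Polynomial.C (-2 * h)) : h ∈ realized 2 0 :=
  mem_realized (basic_mem_basicAlg j) (hj ▸ basic_cubicHom j) (-2) (by norm_num) _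
    (Polynomial.natDegree_C _).le (by rw [Polynomial.coeff_C_zero, map_neg, map_ofNat]) e

theorem uvar_mem_realized : uvar 2 ∈ realized 2 0 :=
  letter_mem_realized 3 rfl
    (by rw [slice_basic]; simp [basicVal, pairing, hess, map_ofNat Polynomial.C]; ring)

theorem vvar_mem_realized : vvar 2 ∈ realized 2 0 :=
  letter_mem_realized 4 rfl
    (by rw [slice_basic]; simp [basicVal, pairing, hess, map_ofNat Polynomial.C]; ring)

theorem mfun_mem_realized : mfun ∈ realized 2 0 :=
  letter_mem_realized 6 rfl
    (by rw [slice_basic]; simp [basicVal, pairing, hess, cross, mfun, map_ofNat Polynomial.C]; ring)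

theorem quadratic_block {h : Quad} (j : Fin 18) (hj : basicDegree j 2 = 2) (β γ : Quad)
    (e : slice (basic j) = Polynomial.C (18 * h) * Polynomial.X ^ 2 +
      Polynomial.C β * Polynomial.X + Polynomial.C γ) : h ∈ realized 2 2 :=
  mem_realized (basic_mem_basicAlg j) (hj ▸ basic_cubicHom j) 18 (by norm_num) _
    Polynomial.natDegree_quadratic_le
    (by rw [Polynomial.coeff_add, Polynomial.coeff_add, Polynomial.coeff_C_mul_X_pow,
          Polynomial.coeff_C_mul_X, Polynomial.coeff_C_of_ne_zero two_ne_zero, map_ofNat]; simp) e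

theorem linear_block {h : Quad} {a : Poly} (ha : a ∈ basicAlg) (hk : CubicHom a 4) (r : ℂ)
    (hr : r ≠ 0) (γ : Quad) (e : slice a = Polynomial.C (C r * h) * Polynomial.X + Polynomial.C γ) :
    h ∈ realized 4 1 :=
  mem_realized ha hk r hr _ Polynomial.natDegree_linear_le
    (by
      rw [Polynomial.coeff_add, Polynomial.coeff_C_mul_X, Polynomial.coeff_C_of_ne_zero one_ne_zero]
      simp) e

/-- The cubic monomials in `c`, `c'`, `m`, at most linear in `m`, have the property `p` if the
seven of them do. -/
theorem cubic_monomial_cases {p : Quad → Prop} (h₁ : p (uvar 2 ^ 3)) (h₂ : p (uvar 2 ^ 2 * vvar 2))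
    (h₃ : p (uvar 2 * vvar 2 ^ 2)) (h₄ : p (vvar 2 ^ 3)) (h₅ : p (uvar 2 ^ 2 * mfun))
    (h₆ : p (uvar 2 * vvar 2 * mfun)) (h₇ : p (vvar 2 ^ 2 * mfun)) {i j ε : ℕ} (hε : ε ≤ 1)
    (h : i + j + ε = 3) : p (uvar 2 ^ i * vvar 2 ^ j * mfun ^ ε) := by
  obtain rfl : j = 3 - ε - i := by omega
  interval_cases ε
  · have : i ≤ 3 := by omega
    interval_cases i
    · simpa using h₄
    · simpa using h₃
    · simpa using h₂
    · simpa using h₁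
  · have : i ≤ 2 := by omega
    interval_cases i
    · simpa using h₇
    · simpa using h₆
    · simpa using h₅

section Restriction

variable {B : Type*} [CommRing B]

theorem bil_lin_slice (q u v : Fin 3 → B) :
    bil (fun k => Polynomial.C (q k)) (lin ![Polynomial.X, 1, 0, 0] fun k => Polynomial.C (u k))
      (lin ![Polynomial.X, 1, 0, 0] fun k => Polynomial.C (v k)) =
    Polynomial.C (18 * (q 2 * u 2 * v 2)) * Polynomial.X ^ 2 +
      Polynomial.C (-6 * (q 1 * u 2 * v 2 + q 2 * (u 2 * v 1 + u 1 * v 2))) * Polynomial.X +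
      Polynomial.C (2 * q 0 * u 2 * v 2 + q 1 * (u 1 * v 2 + u 2 * v 1) + 2 * q 2 * u 1 * v 1) := by
  simp [bil, lin, map_ofNat Polynomial.C]
  ring

theorem bil_jac_slice (q u : Fin 3 → B) :
    bil (fun k => Polynomial.C (q k)) (lin ![Polynomial.X, 1, 0, 0] fun k => Polynomial.C (u k))
      (lin (jac ![Polynomial.X, 1, 0, 0] (hess ![Polynomial.X, 1, 0, 0]))
        fun k => Polynomial.C (u k)) =
    Polynomial.C (36 * (q 2 * u 2 ^ 2)) * Polynomial.X +
      Polynomial.C (-6 * q 1 * u 2 ^ 2 - 12 * q 2 * u 1 * u 2) := by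
  simp [bil, lin, jac, hess, map_ofNat Polynomial.C]
  ring

theorem cross_slice (u v : Fin 3 → B) :
    cross (fun k => Polynomial.C (u k)) (fun k => Polynomial.C (v k)) =
      fun k => Polynomial.C (cross u v k) := by
  ext1 k; fin_cases k <;> simp [cross, map_ofNat Polynomial.C]

theorem pairing_hess_slice (u : Fin 3 → B) :
    pairing (fun k => Polynomial.C (u k)) (hess ![Polynomial.X, 1, 0, 0]) =
      Polynomial.C (-2 * u 2) := by
  simp [pairing, hess, map_ofNat Polynomial.C]

end Restriction

theorem cubic_mem_realized₂ {i j ε : ℕ} (hε : ε ≤ 1) (h : i + j + ε = 3) :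
    uvar 2 ^ i * vvar 2 ^ j * mfun ^ ε ∈ realized 2 2 := by
  have key : ∀ (n : Fin 18) (q u v : Fin 3 → Quad) (g : Quad), basicDegree n 2 = 2 →
      slice (basic n) = bil (fun k => Polynomial.C (q k))
        (lin ![Polynomial.X, 1, 0, 0] fun k => Polynomial.C (u k))
        (lin ![Polynomial.X, 1, 0, 0] fun k => Polynomial.C (v k)) →
      q 2 * u 2 * v 2 = g → g ∈ realized 2 2 := by
    rintro n q u v g hn e rfl
    rw [bil_lin_slice] at e
    exact quadratic_block n hn _ _ e
  refine cubic_monomial_cases (p := (· ∈ realized 2 2)) ?_ ?_ ?_ ?_ ?_ ?_ ?_ hε h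
  · exact key 7 uvar uvar uvar _ rfl (slice_basic 7) (by ring)
  · exact key 8 vvar uvar uvar _ rfl (slice_basic 8) (by ring)
  · exact key 9 uvar vvar vvar _ rfl (slice_basic 9) (by ring)
  · exact key 10 vvar vvar vvar _ rfl (slice_basic 10) (by ring)
  · refine key 11 (cross uvar vvar) uvar uvar _ rfl ?_ (by simp [cross, mfun]; ring)
    rw [← cross_slice]; exact slice_basic 11
  · refine key 12 (cross uvar vvar) uvar vvar _ rfl ?_ (by simp [cross, mfun]; ring)
    rw [← cross_slice]; exact slice_basic 12
  · refine key 13 (cross uvar vvar) vvar vvar _ rfl ?_ (by simp [cross, mfun]; ring)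
    rw [← cross_slice]; exact slice_basic 13

theorem cubic_mem_realized₁ {i j ε : ℕ} (hε : ε ≤ 1) (h : i + j + ε = 3) :
    uvar 2 ^ i * vvar 2 ^ j * mfun ^ ε ∈ realized 4 1 := by
  have key : ∀ (n : Fin 18) (q u : Fin 3 → Quad) (g : Quad), basicDegree n 2 = 4 →
      slice (basic n) = bil (fun k => Polynomial.C (q k))
        (lin ![Polynomial.X, 1, 0, 0] fun k => Polynomial.C (u k))
        (lin (jac ![Polynomial.X, 1, 0, 0] (hess ![Polynomial.X, 1, 0, 0]))
          fun k => Polynomial.C (u k)) →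
      q 2 * u 2 ^ 2 = g → g ∈ realized 4 1 := by
    rintro n q u g hn e rfl
    rw [bil_jac_slice] at e
    exact linear_block (basic_mem_basicAlg n) (hn ▸ basic_cubicHom n) 36 (by norm_num) _
      (by rw [e, map_ofNat C])
  have key' : ∀ (n n' : Fin 18) (q r u v : Fin 3 → Quad) (g : Quad), basicDegree n 2 = 2 →
      basicDegree n' 2 = 2 →
      slice (basic n) = bil (fun k => Polynomial.C (q k))
        (lin ![Polynomial.X, 1, 0, 0] fun k => Polynomial.C (u k))
        (lin ![Polynomial.X, 1, 0, 0] fun k => Polynomial.C (u k)) →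
      slice (basic n') = bil (fun k => Polynomial.C (r k))
        (lin ![Polynomial.X, 1, 0, 0] fun k => Polynomial.C (v k))
        (lin ![Polynomial.X, 1, 0, 0] fun k => Polynomial.C (v k)) →
      uvar 2 * q 2 * u 2 ^ 2 = vvar 2 * r 2 * v 2 ^ 2 →
      uvar 2 * (q 1 * u 2 ^ 2 + q 2 * (2 * u 1 * u 2)) -
        vvar 2 * (r 1 * v 2 ^ 2 + r 2 * (2 * v 1 * v 2)) = - g → g ∈ realized 4 1 := by
    intro n n' q r u v g hn hn' e e' h2 h1
    refine linear_block (a := basic 3 * basic n - basic 4 * basic n')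
      (sub_mem (mul_mem (basic_mem_basicAlg _) (basic_mem_basicAlg _))
        (mul_mem (basic_mem_basicAlg _) (basic_mem_basicAlg _)))
      (Submodule.sub_mem (weightedHomogeneousSubmodule ℂ _ 4)
        (show CubicHom _ 4 from (basic_cubicHom 3).mul (hn ▸ basic_cubicHom n : CubicHom _ 2))
        (show CubicHom _ 4 from (basic_cubicHom 4).mul (hn' ▸ basic_cubicHom n' : CubicHom _ 2)))
        (-12) (by norm_num)
      (-2 * uvar 2 * (2 * q 0 * u 2 * u 2 + q 1 * (u 1 * u 2 + u 2 * u 1) + 2 * q 2 * u 1 * u 1) +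
        2 * vvar 2 * (2 * r 0 * v 2 * v 2 + r 1 * (v 1 * v 2 + v 2 * v 1) + 2 * r 2 * v 1 * v 1)) ?_
    have h3 : slice (basic 3) = Polynomial.C (-2 * uvar 2) := by
      rw [← pairing_hess_slice]; exact slice_basic 3
    have h4 : slice (basic 4) = Polynomial.C (-2 * vvar 2) := by
      rw [← pairing_hess_slice]; exact slice_basic 4
    rw [map_sub, map_mul, map_mul, e, e', h3, h4, bil_lin_slice, bil_lin_slice, map_neg C,
      map_ofNat C]
    have h1' := congrArg Polynomial.C h1
    have h2' := congrArg Polynomial.C h2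
    simp only [map_mul, map_pow, map_add, map_neg, map_sub, map_ofNat] at h1' h2' ⊢
    linear_combination (-36 * Polynomial.X ^ 2) * h2' + 12 * Polynomial.X * h1'
  refine cubic_monomial_cases (p := (· ∈ realized 4 1)) ?_ ?_ ?_ ?_ ?_ ?_ ?_ hε h
  · exact key 14 uvar uvar _ rfl (slice_basic 14) (by ring)
  · exact key 15 vvar uvar _ rfl (slice_basic 15) (by ring)
  · exact key 16 uvar vvar _ rfl (slice_basic 16) (by ring)
  · exact key 17 vvar vvar _ rfl (slice_basic 17) (by ring)
  · exact key' 8 7 vvar uvar uvar uvar _ rfl rfl (slice_basic 8) (slice_basic 7) (by ring)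
      (by rw [mfun]; ring)
  · exact key' 9 8 uvar vvar vvar uvar _ rfl rfl (slice_basic 9) (slice_basic 8) (by ring)
      (by rw [mfun]; ring)
  · exact key' 10 9 vvar uvar vvar vvar _ rfl rfl (slice_basic 10) (slice_basic 9) (by ring)
      (by rw [mfun]; ring)

theorem monomial_mem_realized {N i j ε k n : ℕ} (hε : ε ≤ 1) (hN : i + j + ε = N)
    (hkn : k + 2 * n = 2 * N) (h1 : n ≤ k) (h2 : k ≠ n + 1) :
    uvar 2 ^ i * vvar 2 ^ j * mfun ^ ε ∈ realized k n := by
  induction n using Nat.strong_induction_on generalizing N i j ε k with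
  | _ n ih =>
    have peel : ∀ {k' n'}, 3 ≤ N → k' + 2 * n' = 6 →
        (∀ {i j ε : ℕ}, ε ≤ 1 → i + j + ε = 3 →
          uvar 2 ^ i * vvar 2 ^ j * mfun ^ ε ∈ realized k' n') →
        0 < n' → n' ≤ n → k' ≤ k → n - n' ≤ k - k' → k - k' ≠ n - n' + 1 →
        uvar 2 ^ i * vvar 2 ^ j * mfun ^ ε ∈ realized k n := by
      intro k' n' h3 hw hb h4 h5 h6 h7 h8
      set i' := min i (3 - ε) with hi'
      set j' := 3 - ε - i' with hj'
      have := realized_mul (hb (i := i') (j := j') (ε := ε) hε (by omega))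
        (ih (n - n') (by omega) (N := N - 3) (i := i - i') (j := j - j') (ε := 0) (k := k - k')
          (by omega) (by omega) (by omega) h7 h8)
      rw [Nat.add_sub_of_le h5, Nat.add_sub_of_le h6] at this
      convert this using 1
      rw [← Nat.add_sub_of_le (show i' ≤ i by omega), ← Nat.add_sub_of_le (show j' ≤ j by omega),
        pow_add, pow_add, Nat.add_sub_cancel_left, Nat.add_sub_cancel_left]
      ring
    rcases Nat.lt_or_ge 1 n with hn | hn
    · exact peel (by omega) rfl cubic_mem_realized₂ (by omega) (by omega) (by omega) (by omega)
        (by omega)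
    · interval_cases n
      · have := realized_mul (realized_mul (realized_pow uvar_mem_realized i)
          (realized_pow vvar_mem_realized j)) (realized_pow mfun_mem_realized ε)
        convert this using 2 <;> omega
      · exact peel (by omega) rfl cubic_mem_realized₁ (by omega) (by omega) (by omega) (by omega)
          (by omega)

theorem mem_realized_of_mem_span {N k n : ℕ} (hkn : k + 2 * n = 2 * N) (h1 : n ≤ k)
    (h2 : k ≠ n + 1) {h : Quad} (hh : h ∈ covariantSpan N) : h ∈ realized k n := by
  refine (Submodule.span_le (p := realized k n)).2 ?_ hh
  rintro _ ⟨e, ε, hε, hN, rfl⟩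
  have := realized_mul (realized_mul (realized_mul
    (realized_pow (qfun_mem_realized 0 (by decide)) (e 0))
    (realized_pow (qfun_mem_realized 1 (by decide)) (e 1)))
    (realized_pow (qfun_mem_realized 2 (by decide)) (e 2))) (monomial_mem_realized hε hN hkn h1 h2)
  simp only [mul_zero, zero_add] at this
  change _ ∈ realized k n
  convert this using 1
  rw [aeval_monomial, Finsupp.prod_fintype _ _ (by simp), Fin.prod_univ_five, map_one,
    show qfun 3 = uvar 2 from rfl, show qfun 4 = vvar 2 from rfl]
  ring

/-- Up to elements of `basicAlg`, the degree of the restriction of an invariant can be lowered. -/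
theorem exists_basicAlg_coeff_eq {P : Poly} (hP : P ∈ Inv) {k n : ℕ} (h : CubicHom P k)
    (hn : (slice P).natDegree ≤ n) (h1 : n ≤ k) (h2 : k ≠ n + 1) :
    ∃ a ∈ basicAlg, CubicHom a k ∧ (slice a).natDegree ≤ n ∧
      (slice a).coeff n = (slice P).coeff n := by
  change (slice P).coeff n ∈ realized k n
  rcases eq_or_ne ((slice P).coeff n) 0 with h0 | h0
  · rw [h0]; exact zero_mem _
  obtain ⟨d, hd⟩ := support_nonempty.2 h0
  have hw := fun d hd => weight_coeff_slice hP h n (d := d) hd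
  have hkn : k + 2 * n = 2 * ((k + 2 * n) / 2) := by have := hw d hd; omega
  refine mem_realized_of_mem_span hkn h1 h2
    (mem_covariantSpan (mem_covariants_of_shift (eval_shift_coeff hP hn)) fun d hd => ?_)
  have := hw d hd
  omega

/-! ### Divisibility by the discriminant -/

/-- The polynomial functions not involving the first coefficient of the cubic. -/
noncomputable def cubicTail : Subalgebra ℂ Poly where
  carrier := {R | ∀ u v f a, eval (point u v ![a, f 1, f 2, f 3]) R = eval (point u v f) R}
  mul_mem' ha hb u v f a := by rw [map_mul, map_mul, ha, hb]
  add_mem' ha hb u v f a := by rw [map_add, map_add, ha, hb]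
  algebraMap_mem' r u v f a := by simp

theorem X_mem_cubicTail {j : Idx ![2, 2, 3]} (hj : j ≠ ⟨2, 0⟩) : X j ∈ cubicTail := by
  intro u v f a
  rw [eval_X, eval_X]
  obtain ⟨i, k⟩ := j
  fin_cases i
  · rfl
  · rfl
  · change Fin 4 at k
    fin_cases k
    · exact absurd rfl hj
    · rfl
    · rfl
    · rfl

theorem eval_discr (u v : Fin 3 → ℂ) (f : Fin 4 → ℂ) :
    eval (point u v f) (basic 5) = -81 * f 0 ^ 2 * f 3 ^ 2 +
      f 0 * (54 * f 1 * f 2 * f 3 - 12 * f 2 ^ 3) + 3 * f 1 ^ 2 * f 2 ^ 2 -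
      12 * f 1 ^ 3 * f 3 := by
  rw [eval_basic]
  simp [basicVal, pairing, hess]
  ring

theorem poly_ext {P Q : Poly}
    (h : ∀ u v f, eval (point u v f) P = eval (point u v f) Q) : P = Q :=
  MvPolynomial.funext fun x => by rw [eq_point x]; exact h _ _ _

theorem discr_ne_zero : basic 5 ≠ 0 := by
  intro h
  have := eval_discr 0 0 ![0, 1, 1, 0]
  rw [h] at this
  simp at this

/-- The coefficient functions of the cubic. -/
noncomputable def cvar (k : Fin 4) : Poly := X ⟨2, k⟩

theorem eval_cvar (u v : Fin 3 → ℂ) (f : Fin 4 → ℂ) (k : Fin 4) :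
    eval (point u v f) (cvar k) = f k := eval_X _

theorem cvar_mem_cubicTail {k : Fin 4} (hk : k ≠ 0) : cvar k ∈ cubicTail := by
  refine X_mem_cubicTail fun h => hk ?_
  exact eq_of_heq (Sigma.mk.inj h).2

theorem discr_eq : basic 5 = C (-81) * cvar 0 ^ 2 * cvar 3 ^ 2 + cvar 0 *
    (C 54 * cvar 1 * cvar 2 * cvar 3 - C 12 * cvar 2 ^ 3) +
    (C 3 * cvar 1 ^ 2 * cvar 2 ^ 2 - C 12 * cvar 1 ^ 3 * cvar 3) := by
  refine poly_ext fun u v f => ?_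
  rw [eval_discr]
  simp only [map_add, map_mul, map_sub, map_pow, eval_C, eval_cvar]
  ring

section PseudoDivision

variable {A : Type*} [CommRing A] [Algebra ℂ A] {T : Subalgebra ℂ A} {D x y b c : A}

theorem pseudo_division_add {p p' : A} (hy : y ∈ T)
    (h : ∃ M : ℕ, ∃ Q, ∃ R₁ ∈ T, ∃ R₀ ∈ T, y ^ M * p = D * Q + R₁ * x + R₀)
    (h' : ∃ M : ℕ, ∃ Q, ∃ R₁ ∈ T, ∃ R₀ ∈ T, y ^ M * p' = D * Q + R₁ * x + R₀) :
    ∃ M : ℕ, ∃ Q, ∃ R₁ ∈ T, ∃ R₀ ∈ T, y ^ M * (p + p') = D * Q + R₁ * x + R₀ := by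
  obtain ⟨M, Q, R₁, h₁, R₀, h₀, e⟩ := h
  obtain ⟨M', Q', R₁', h₁', R₀', h₀', e'⟩ := h'
  refine ⟨M + M', y ^ M' * Q + y ^ M * Q', y ^ M' * R₁ + y ^ M * R₁',
    add_mem (mul_mem (pow_mem hy _) h₁) (mul_mem (pow_mem hy _) h₁'),
    y ^ M' * R₀ + y ^ M * R₀',
    add_mem (mul_mem (pow_mem hy _) h₀) (mul_mem (pow_mem hy _) h₀'), ?_⟩
  rw [pow_add]
  linear_combination y ^ M' * e + y ^ M * e'

theorem pseudo_division_mul {p a : A} (hy : y ∈ T) (hb : b ∈ T) (hc : c ∈ T)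
    (hD : a * D = x * b + c - x ^ 2 * y ^ 2)
    (h : ∃ M : ℕ, ∃ Q, ∃ R₁ ∈ T, ∃ R₀ ∈ T, y ^ M * p = D * Q + R₁ * x + R₀) :
    ∃ M : ℕ, ∃ Q, ∃ R₁ ∈ T, ∃ R₀ ∈ T, y ^ M * (p * x) = D * Q + R₁ * x + R₀ := by
  obtain ⟨M, Q, R₁, h₁, R₀, h₀, e⟩ := h
  refine ⟨M + 2, y ^ 2 * x * Q - a * R₁, R₁ * b + y ^ 2 * R₀,
    add_mem (mul_mem h₁ hb) (mul_mem (pow_mem hy 2) h₀), R₁ * c, mul_mem h₁ hc, ?_⟩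
  linear_combination y ^ 2 * x * e + R₁ * hD

end PseudoDivision

/-- Pseudo-division by the discriminant, as a polynomial in the first coefficient of the
cubic. -/
theorem exists_pseudo_division (P : Poly) : ∃ M : ℕ, ∃ Q : Poly, ∃ R₁ ∈ cubicTail,
    ∃ R₀ ∈ cubicTail, cvar 3 ^ M * P = basic 5 * Q + R₁ * cvar 0 + R₀ := by
  have h1 : cvar 1 ∈ cubicTail := cvar_mem_cubicTail (by decide)
  have h2 : cvar 2 ∈ cubicTail := cvar_mem_cubicTail (by decide)
  have h3 : cvar 3 ∈ cubicTail := cvar_mem_cubicTail (by decide)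
  have hC : ∀ r, (C r : Poly) ∈ cubicTail := cubicTail.algebraMap_mem
  induction P using MvPolynomial.induction_on with
  | C r => exact ⟨0, 0, 0, zero_mem _, C r, hC r, by simp⟩
  | add p q hp hq => exact pseudo_division_add h3 hp hq
  | mul_X p j hp =>
    rcases eq_or_ne j ⟨2, 0⟩ with rfl | hj
    · have h81 : (C 81⁻¹ : Poly) * C (-81) = -1 := by
        rw [← C_mul, ← C_1, ← C_neg]; norm_num
      refine pseudo_division_mul h3
        (mul_mem (hC 81⁻¹) (sub_mem (mul_mem (mul_mem (mul_mem (hC 54) h1) h2) h3)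
          (mul_mem (hC 12) (pow_mem h2 3))))
        (mul_mem (hC 81⁻¹) (sub_mem (mul_mem (mul_mem (hC 3) (pow_mem h1 2)) (pow_mem h2 2))
          (mul_mem (mul_mem (hC 12) (pow_mem h1 3)) h3))) (a := C 81⁻¹) ?_ hp
      rw [discr_eq]
      change _ = cvar 0 * _ + _ - cvar 0 ^ 2 * _
      linear_combination cvar 0 ^ 2 * cvar 3 ^ 2 * h81
    · obtain ⟨M, Q, R₁, h₁, R₀, h₀, e⟩ := hp
      refine ⟨M, Q * X j, R₁ * X j, mul_mem h₁ (X_mem_cubicTail hj), R₀ * X j,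
        mul_mem h₀ (X_mem_cubicTail hj), ?_⟩
      rw [← mul_assoc, e]
      ring

theorem eval_eq_zero_of_double_root {P : Poly} (hP : P ∈ Inv)
    (h : ∀ u v, eval (point u v ![0, 1, 0, 0]) P = 0) {r s l : ℂ} (hrs : r ≠ s) (hl : l ≠ 0)
    (u v : Fin 3 → ℂ) :
    eval (point u v ![-(l * r ^ 2 * s), l * (r ^ 2 + 2 * r * s), -(l * (2 * r + s)), l]) P = 0 := by
  have hs : s - r ≠ 0 := sub_ne_zero.2 hrs.symm
  have hr : r - s ≠ 0 := sub_ne_zero.2 hrs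
  rw [← mem_inv_iff.1 hP (1 / (l * (s - r) ^ 2)) (l * (r - s)) (s / (l * (s - r) ^ 2))
    (r * (l * (r - s))) (by field_simp; ring)]
  refine (eval_congr_cubic ?_ P).trans (h _ _)
  ext i
  fin_cases i <;> simp [sub₃] <;> field_simp <;> ring

theorem cvar_dvd_of_eval {k : Fin 4} {P G : Poly} (hG : ∃ x, eval x (cvar k) = 0 ∧ eval x G ≠ 0)
    (h : ∀ x, eval x (cvar k) = 0 → eval x G ≠ 0 → eval x P = 0) : cvar k ∣ P := by
  have hX : ∀ x : Idx ![2, 2, 3] → ℂ, eval x (cvar k) = x ⟨2, k⟩ := fun x => eval_X _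
  simp only [hX] at hG h
  exact X_dvd_of_eval _ hG h

theorem cvar_dvd_of_discr_mul {P Q R : Poly} (e : cvar 3 * R * P = basic 5 * Q) :
    cvar 3 ∣ Q := by
  have h0 : eval (point 0 0 ![0, 1, 1, 0]) (cvar 3) = 0 := by rw [eval_cvar]; simp
  have h1 : eval (point 0 0 ![0, 1, 1, 0]) (basic 5) ≠ 0 := by rw [eval_discr]; simp
  refine cvar_dvd_of_eval ⟨_, h0, h1⟩ fun x h3 hD => ?_
  have e' := congrArg (eval x) e
  rw [map_mul, map_mul, map_mul, h3, zero_mul, zero_mul] at e'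
  exact (mul_eq_zero.1 e'.symm).resolve_left hD

theorem eval_remainder_eq_zero {P Q R₁ R₀ : Poly} {M : ℕ} (hP : P ∈ Inv)
    (h : ∀ u v, eval (point u v ![0, 1, 0, 0]) P = 0) (h₁ : R₁ ∈ cubicTail)
    (h₀ : R₀ ∈ cubicTail) (e : cvar 3 ^ M * P = basic 5 * Q + R₁ * cvar 0 + R₀)
    (u v : Fin 3 → ℂ) (f : Fin 4 → ℂ) {w : ℂ} (h3 : f 3 ≠ 0)
    (hw : f 2 ^ 2 - 3 * f 1 * f 3 = w ^ 2) (hw0 : w ≠ 0) :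
    eval (point u v f) R₁ * ((f 2 ^ 3 - 3 * f 2 * w ^ 2 + 2 * w ^ 3) / (27 * f 3 ^ 2)) +
      eval (point u v f) R₀ = 0 := by
  have hf1 : f 1 = (f 2 ^ 2 - w ^ 2) / (3 * f 3) := by
    field_simp; linear_combination -hw
  have hf : (![-(f 3 * ((-f 2 + w) / (3 * f 3)) ^ 2 * ((-f 2 - 2 * w) / (3 * f 3))),
      f 3 * (((-f 2 + w) / (3 * f 3)) ^ 2 +
        2 * ((-f 2 + w) / (3 * f 3)) * ((-f 2 - 2 * w) / (3 * f 3))),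
      -(f 3 * (2 * ((-f 2 + w) / (3 * f 3)) + (-f 2 - 2 * w) / (3 * f 3))), f 3] :
        Fin 4 → ℂ) =
      ![(f 2 ^ 3 - 3 * f 2 * w ^ 2 + 2 * w ^ 3) / (27 * f 3 ^ 2), f 1, f 2, f 3] := by
    rw [hf1]
    ext i
    fin_cases i <;> simp <;> field_simp <;> ring
  have hz := eval_eq_zero_of_double_root hP h (r := (-f 2 + w) / (3 * f 3))
    (s := (-f 2 - 2 * w) / (3 * f 3)) (l := f 3) (by
      intro hrs
      field_simp at hrs
      exact hw0 (by linear_combination hrs / 3)) h3 u v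
  rw [hf] at hz
  have hd : eval (point u v
      ![(f 2 ^ 3 - 3 * f 2 * w ^ 2 + 2 * w ^ 3) / (27 * f 3 ^ 2), f 1, f 2, f 3])
        (basic 5) = 0 := by
    rw [eval_discr]
    simp only [Matrix.cons_val, hf1]
    field_simp
    ring
  have e' := congrArg (eval (point u v
    ![(f 2 ^ 3 - 3 * f 2 * w ^ 2 + 2 * w ^ 3) / (27 * f 3 ^ 2), f 1, f 2, f 3])) e
  rw [map_mul, hz, mul_zero, map_add, map_add, map_mul, map_mul, h₁, h₀, eval_cvar, hd, zero_mul,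
    zero_add] at e'
  exact e'.symm

theorem eq_zero_of_generic {R : Poly} (hR : ∀ (u v : Fin 3 → ℂ) (f : Fin 4 → ℂ), f 3 ≠ 0 →
    f 2 ^ 2 - 3 * f 1 * f 3 ≠ 0 → eval (point u v f) R = 0) : R = 0 := by
  have evG : ∀ u v f, eval (point u v f) (cvar 3 * (cvar 2 ^ 2 - C 3 * cvar 1 * cvar 3)) =
      f 3 * (f 2 ^ 2 - 3 * f 1 * f 3) := by
    intro u v f
    simp only [map_mul, map_sub, map_pow, eval_cvar, eval_C]
  have hG0 : cvar 3 * (cvar 2 ^ 2 - C 3 * cvar 1 * cvar 3) ≠ 0 := by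
    intro h0
    have := evG 0 0 ![0, 0, 1, 1]
    rw [h0] at this
    simp at this
  refine (mul_eq_zero.1 (?_ : R * _ = 0)).resolve_right hG0
  refine poly_ext fun u v f => ?_
  rw [map_mul, evG, map_zero]
  by_cases h3 : f 3 = 0
  · rw [h3]; ring
  by_cases h2 : f 2 ^ 2 - 3 * f 1 * f 3 = 0
  · rw [h2]; ring
  · rw [hR _ _ _ h3 h2, zero_mul]

theorem discr_dvd_of_cvar_pow_mul {P : Poly} (M : ℕ) :
    ∀ Q, cvar 3 ^ M * P = basic 5 * Q → basic 5 ∣ P := by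
  induction M with
  | zero => exact fun Q e => ⟨Q, by rw [← e, pow_zero, one_mul]⟩
  | succ M ih =>
    intro Q e
    rw [pow_succ'] at e
    obtain ⟨Q', rfl⟩ := cvar_dvd_of_discr_mul e
    have h0 : cvar 3 ≠ 0 := X_ne_zero _
    refine ih Q' (mul_left_cancel₀ h0 ?_)
    rw [← mul_assoc, e, mul_left_comm]

theorem discr_dvd {P : Poly} (hP : P ∈ Inv)
    (h : ∀ u v, eval (point u v ![0, 1, 0, 0]) P = 0) : basic 5 ∣ P := by
  obtain ⟨M, Q, R₁, h₁, R₀, h₀, e⟩ := exists_pseudo_division P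
  have hR : ∀ (u v : Fin 3 → ℂ) (f : Fin 4 → ℂ), f 3 ≠ 0 → f 2 ^ 2 - 3 * f 1 * f 3 ≠ 0 →
      eval (point u v f) R₁ = 0 ∧ eval (point u v f) R₀ = 0 := by
    intro u v f h3 h2
    obtain ⟨w, hw⟩ := IsAlgClosed.exists_pow_nat_eq (f 2 ^ 2 - 3 * f 1 * f 3) two_pos
    have hw0 : w ≠ 0 := by rintro rfl; exact h2 (by rw [← hw]; ring)
    have e1 := eval_remainder_eq_zero hP h h₁ h₀ e u v f h3 hw.symm hw0
    have e2 := eval_remainder_eq_zero hP h h₁ h₀ e u v f (w := -w) h3 (by rw [← hw]; ring)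
      (neg_ne_zero.2 hw0)
    have e3 : eval (point u v f) R₁ * (4 * w ^ 3 / (27 * f 3 ^ 2)) = 0 := by
      linear_combination e1 - e2
    have e4 : eval (point u v f) R₁ = 0 :=
      (mul_eq_zero.1 e3).resolve_right
        (div_ne_zero (mul_ne_zero (by norm_num) (pow_ne_zero _ hw0))
          (mul_ne_zero (by norm_num) (pow_ne_zero _ h3)))
    exact ⟨e4, by rwa [e4, zero_mul, zero_add] at e1⟩
  rw [eq_zero_of_generic fun u v f h3 h2 => (hR u v f h3 h2).1,
    eq_zero_of_generic fun u v f h3 h2 => (hR u v f h3 h2).2,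
    zero_mul, add_zero, add_zero] at e
  exact discr_dvd_of_cvar_pow_mul M Q e

/-- A factor of an invariant is invariant if the other factor is. -/
theorem mem_inv_of_mul {D Q : Poly} (hD : D ∈ Inv) (hD0 : D ≠ 0) (h : D * Q ∈ Inv) : Q ∈ Inv := by
  rw [mem_inv_iff] at hD h ⊢
  intro α β γ δ hdet
  let T : Poly := aeval (point
    (sub₂ (C α) (C β) (C γ) (C δ) fun k => X ⟨0, k⟩)
    (sub₂ (C α) (C β) (C γ) (C δ) fun k => X ⟨1, k⟩)
    (sub₃ (C α) (C β) (C γ) (C δ) fun k => X ⟨2, k⟩)) Q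
  have hT : ∀ u v f, eval (point u v f) T =
      eval (point (sub₂ α β γ δ u) (sub₂ α β γ δ v) (sub₃ α β γ δ f)) Q := by
    intro u v f
    rw [eval_eq_aeval, aeval_point_comp, ← eval_eq_aeval]
    refine congrArg (fun x => eval x Q) ?_
    congr 1
    · ext k; fin_cases k <;> simp [sub₂, point, map_ofNat]
    · ext k; fin_cases k <;> simp [sub₂, point, map_ofNat]
    · ext k; fin_cases k <;> simp [sub₃, point, map_ofNat]
  have hz : D * (T - Q) = 0 := by
    refine poly_ext fun u v f => ?_
    rw [map_mul, map_sub, hT, map_zero]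
    have h1 := h α β γ δ hdet u v f
    rw [map_mul, map_mul, hD α β γ δ hdet] at h1
    linear_combination h1
  have hTQ := sub_eq_zero.1 ((mul_eq_zero.1 hz).resolve_left hD0)
  intro u v f
  rw [← hT, hTQ]

theorem exists_cubicHom_factor {P Q : Poly} {k m : ℕ} (hP : CubicHom P k) {D : Poly}
    (hD : CubicHom D m) (hD0 : D ≠ 0) (hP0 : P ≠ 0) (e : P = D * Q) :
    m ≤ k ∧ CubicHom Q (k - m) := by
  have key : C (2 ^ m) * aeval (fun j => C (2 ^ blockWeight ![0, 0, 1] j) * X j :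
      Idx ![2, 2, 3] → Poly) Q = C (2 ^ k) * Q := by
    apply mul_left_cancel₀ hD0
    apply MvPolynomial.funext
    intro x
    have h1 := aeval_scale hP (2 : ℂ) x
    have h2 := aeval_scale hD (2 : ℂ) x
    rw [← eval_eq_aeval, ← eval_eq_aeval] at h1 h2
    rw [e, map_mul, map_mul, h2] at h1
    simp only [map_mul, eval_aeval_scale, eval_C]
    linear_combination h1
  have hQ0 : Q ≠ 0 := by rintro rfl; exact hP0 (by rw [e, mul_zero])
  obtain ⟨d, hd⟩ := ne_zero_iff.1 hQ0
  have := weight_eq_of_scale key hd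
  refine ⟨by omega, fun d hd => ?_⟩
  have := weight_eq_of_scale key hd
  omega

/-! ### Generation by the basic invariants -/

theorem mem_basicAlg_of_cubicHom (k : ℕ) : ∀ P ∈ Inv, CubicHom P k → P ∈ basicAlg := by
  induction k using Nat.strong_induction_on with
  | _ k ih =>
    suffices H : ∀ n, ∀ P ∈ Inv, CubicHom P k → (∀ m ≥ n, (slice P).coeff m = 0) →
        P ∈ basicAlg from fun P hP hk =>
      H (k + 1) P hP hk fun m hm =>
        Polynomial.coeff_eq_zero_of_natDegree_lt (by have := natDegree_slice_le hk; omega)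
    intro n
    induction n with
    | zero =>
      intro P hP hk h0
      rcases eq_or_ne P 0 with rfl | hP0
      · exact zero_mem _
      have hs : slice P = 0 := Polynomial.ext fun m => h0 m (Nat.zero_le m)
      obtain ⟨Q, e⟩ := discr_dvd hP fun u v => by
        rw [← eval_sliceAt, ← Polynomial.coeff_zero_eq_eval_zero, coeff_sliceAt, hs]
        simp
      obtain ⟨h4, hQ⟩ := exists_cubicHom_factor hk (basic_cubicHom 5) discr_ne_zero hP0 e
      change 4 ≤ k at h4
      rw [e]
      exact mul_mem (basic_mem_basicAlg 5)
        (ih _ (by change k - 4 < k; omega) Q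
          (mem_inv_of_mul (basic_mem 5) discr_ne_zero (e ▸ hP)) hQ)
    | succ n ihn =>
      intro P hP hk h0
      have hdeg : (slice P).natDegree ≤ n :=
        Polynomial.natDegree_le_iff_coeff_eq_zero.2 fun m hm => h0 m hm
      have step : (slice P).coeff n = 0 → P ∈ basicAlg := fun hn =>
        ihn P hP hk fun m hm => by
          rcases hm.eq_or_lt with rfl | hm
          · exact hn
          · exact h0 m hm
      rcases Nat.lt_or_ge k n with hkn | hkn
      · exact step (Polynomial.coeff_eq_zero_of_natDegree_lt
          ((natDegree_slice_le hk).trans_lt hkn))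
      rcases eq_or_ne k (n + 1) with rfl | hkn'
      · exact step (coeff_slice_pred hP hk (h0 _ le_rfl))
      obtain ⟨a, ha, hak, han, e⟩ := exists_basicAlg_coeff_eq hP hk hdeg hkn hkn'
      have := ihn (P - a) (sub_mem hP (basicAlg_le ha))
        (Submodule.sub_mem (weightedHomogeneousSubmodule ℂ _ k) hk hak) fun m hm => by
          rw [map_sub, Polynomial.coeff_sub]
          rcases hm.eq_or_lt with rfl | hm
          · rw [e, sub_self]
          · rw [h0 m hm, Polynomial.coeff_eq_zero_of_natDegree_lt (han.trans_lt hm), sub_self]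
      rw [← sub_add_cancel P a]
      exact add_mem this ha

theorem basicAlg_eq : basicAlg = Inv := by
  refine le_antisymm basicAlg_le fun P hP => ?_
  rw [← sum_weightedHomogeneousComponent (blockWeight ![0, 0, 1]) P]
  exact finsum_induction (· ∈ basicAlg) (zero_mem _) (fun _ _ => add_mem) fun k =>
    mem_basicAlg_of_cubicHom k _ (component_mem hP _ k)
      (weightedHomogeneousComponent_isWeightedHomogeneous k P)

theorem blockWeight_one : blockWeight ![1, 1, 1] = 1 := by
  ext ⟨j, k⟩
  fin_cases j <;> rfl

theorem basic_isHomogeneous (i : Fin 18) :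
    (basic i).IsHomogeneous (basicDegree i 0 + basicDegree i 1 + basicDegree i 2) := by
  have h := basic_isWeightedHomogeneous ![1, 1, 1] i
  rw [blockWeight_one] at h
  simpa [IsHomogeneous] using h

/-- An invariant vanishing on the cubics `x² y + b y³` is zero. -/
theorem eq_zero_of_eval_normal {P : Poly} (hP : P ∈ Inv)
    (h : ∀ u v b, eval (point u v ![0, 1, 0, b]) P = 0) : P = 0 := by
  induction hn : P.totalDegree using Nat.strong_induction_on generalizing P with
  | _ n ih =>
    by_contra hP0
    obtain ⟨Q, e⟩ := discr_dvd hP fun u v => h u v 0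
    have hQ0 : Q ≠ 0 := by rintro rfl; exact hP0 (by rw [e, mul_zero])
    have hdeg : (basic 5).totalDegree = 4 := (basic_isHomogeneous 5).totalDegree discr_ne_zero
    have htd := totalDegree_mul_of_isDomain discr_ne_zero hQ0
    rw [← e] at htd
    refine hQ0 (ih Q.totalDegree (by omega) (mem_inv_of_mul (basic_mem 5) discr_ne_zero (e ▸ hP))
      ?_ rfl)
    intro u v b
    have hfam : family u v ![0, 1, 0, Polynomial.X] Q = 0 := by
      have : Polynomial.X * family u v ![0, 1, 0, Polynomial.X] Q = 0 := by
        refine Polynomial.funext fun b => ?_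
        have e' := congrArg (eval (point u v ![0, 1, 0, b])) e
        rw [h, map_mul, eval_discr] at e'
        have hf : (fun k => (![0, 1, 0, Polynomial.X] k).eval b) = ![0, 1, 0, b] := by
          ext i; fin_cases i <;> simp
        rw [Polynomial.eval_mul, eval_family, Polynomial.eval_X, Polynomial.eval_zero, hf]
        simp only [Matrix.cons_val] at e'
        linear_combination e' / 12
      exact (mul_eq_zero.1 this).resolve_left Polynomial.X_ne_zero
    have := eval_family u v ![0, 1, 0, Polynomial.X] Q b
    rw [hfam] at this
    refine (eval_congr_cubic ?_ Q).trans (this.symm.trans (by simp))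
    ext i; fin_cases i <;> simp

/-! ### Relations between the basic invariants -/

section Relations

variable {B : Type*} [CommRing B]

/-- Polynomial expressions in eighteen quantities that vanish on the basic invariants. -/
def relations (x : Fin 18 → B) : Fin 11 → B :=
  ![x 6 ^ 2 - x 0 * x 2 * x 5 + x 0 * x 4 ^ 2 + x 1 ^ 2 * x 5 - 2 * x 1 * x 3 * x 4 +
      x 2 * x 3 ^ 2,
    4 * x 8 ^ 2 - 4 * x 7 * x 9 + x 0 ^ 2 * x 2 * x 5 - x 0 * x 1 ^ 2 * x 5 -
      x 0 * x 2 * x 3 ^ 2 - 4 * x 0 * x 4 * x 8 + x 1 ^ 2 * x 3 ^ 2 + 4 * x 1 * x 3 * x 8,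
    4 * x 9 ^ 2 - 4 * x 8 * x 10 + x 0 * x 2 ^ 2 * x 5 - x 0 * x 2 * x 4 ^ 2 -
      x 1 ^ 2 * x 2 * x 5 + x 1 ^ 2 * x 4 ^ 2 + 4 * x 1 * x 4 * x 9 - 4 * x 2 * x 3 * x 9,
    2 * x 8 * x 9 - 2 * x 7 * x 10 + x 0 * x 1 * x 2 * x 5 - 2 * x 0 * x 1 * x 4 ^ 2 +
      x 0 * x 2 * x 3 * x 4 - 2 * x 0 * x 4 * x 9 - x 1 ^ 3 * x 5 + 3 * x 1 ^ 2 * x 3 * x 4 -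
      2 * x 1 * x 2 * x 3 ^ 2 + 2 * x 1 * x 3 * x 9 + 2 * x 1 * x 4 * x 8 -
      2 * x 2 * x 3 * x 8,
    4 * x 11 ^ 2 - x 0 ^ 3 * x 4 ^ 2 + 2 * x 0 ^ 2 * x 1 * x 3 * x 4 +
      4 * x 0 ^ 2 * x 4 * x 8 - x 0 ^ 2 * x 6 ^ 2 - x 0 * x 1 ^ 2 * x 3 ^ 2 -
      4 * x 0 * x 1 * x 3 * x 8 + 4 * x 0 * x 7 * x 9 - 8 * x 1 * x 7 * x 8 +
      4 * x 2 * x 7 ^ 2,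
    4 * x 12 ^ 2 + 3 * x 0 * x 1 ^ 2 * x 2 * x 5 - 5 * x 0 * x 1 ^ 2 * x 4 ^ 2 +
      2 * x 0 * x 1 * x 2 * x 3 * x 4 - 4 * x 0 * x 1 * x 4 * x 9 - x 0 * x 2 * x 6 ^ 2 +
      4 * x 0 * x 8 * x 10 - 3 * x 1 ^ 4 * x 5 + 8 * x 1 ^ 3 * x 3 * x 4 -
      5 * x 1 ^ 2 * x 2 * x 3 ^ 2 + 4 * x 1 ^ 2 * x 3 * x 9 + 4 * x 1 ^ 2 * x 4 * x 8 -
      4 * x 1 * x 2 * x 3 * x 8 - 8 * x 1 * x 7 * x 10 + 4 * x 2 * x 7 * x 9,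
    4 * x 13 ^ 2 + 4 * x 0 * x 10 ^ 2 - x 1 ^ 2 * x 2 * x 4 ^ 2 +
      2 * x 1 * x 2 ^ 2 * x 3 * x 4 - 4 * x 1 * x 2 * x 4 * x 9 - 8 * x 1 * x 9 * x 10 -
      x 2 ^ 3 * x 3 ^ 2 + 4 * x 2 ^ 2 * x 3 * x 9 - x 2 ^ 2 * x 6 ^ 2 + 4 * x 2 * x 8 * x 10,
    4 * x 14 ^ 2 + 9 * x 0 ^ 3 * x 5 ^ 2 - 18 * x 0 ^ 2 * x 3 ^ 2 * x 5 +
      9 * x 0 * x 3 ^ 4 - 36 * x 0 * x 3 * x 5 * x 7 + 36 * x 3 ^ 3 * x 7 +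
      36 * x 5 * x 7 ^ 2,
    4 * x 15 ^ 2 + 9 * x 0 * x 1 ^ 2 * x 5 ^ 2 - 9 * x 0 * x 2 * x 3 ^ 2 * x 5 -
      9 * x 1 ^ 2 * x 3 ^ 2 * x 5 - 36 * x 1 * x 3 * x 5 * x 8 + 9 * x 2 * x 3 ^ 4 +
      36 * x 3 ^ 2 * x 4 * x 8 + 36 * x 5 * x 7 * x 9,
    4 * x 16 ^ 2 - 9 * x 0 * x 2 * x 4 ^ 2 * x 5 + 9 * x 0 * x 4 ^ 4 +
      9 * x 1 ^ 2 * x 2 * x 5 ^ 2 - 9 * x 1 ^ 2 * x 4 ^ 2 * x 5 - 36 * x 1 * x 4 * x 5 * x 9 +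
      36 * x 3 * x 4 ^ 2 * x 9 + 36 * x 5 * x 8 * x 10,
    4 * x 17 ^ 2 + 9 * x 2 ^ 3 * x 5 ^ 2 - 18 * x 2 ^ 2 * x 4 ^ 2 * x 5 +
      9 * x 2 * x 4 ^ 4 - 36 * x 2 * x 4 * x 5 * x 10 + 36 * x 4 ^ 3 * x 10 +
      36 * x 5 * x 10 ^ 2]

theorem map_relations {B' : Type*} [CommRing B'] (φ : B →+* B') (x : Fin 18 → B) (i : Fin 11) :
    φ (relations x i) = relations (φ ∘ x) i := by
  have h2 := map_ofNat φ 2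
  have h3 := map_ofNat φ 3
  have h4 := map_ofNat φ 4
  have h5 := map_ofNat φ 5
  have h8 := map_ofNat φ 8
  have h9 := map_ofNat φ 9
  have h18 := map_ofNat φ 18
  have h36 := map_ofNat φ 36
  fin_cases i <;>
    simp only [relations, Fin.reduceFinMk, Matrix.cons_val, map_add, map_sub, map_mul, map_pow,
      Function.comp_apply, h2, h3, h4, h5, h8, h9, h18, h36]

/-- The basic invariants at a cubic `x² y + b y³`. -/
theorem basicVal_normal (u v : Fin 3 → B) (b : B) :
    basicVal u v ![0, 1, 0, b] =
      ![4 * u 0 * u 2 - u 1 ^ 2, 2 * u 0 * v 2 - u 1 * v 1 + 2 * u 2 * v 0,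
        4 * v 0 * v 2 - v 1 ^ 2, 6 * b * u 0 - 2 * u 2, 6 * b * v 0 - 2 * v 2, -12 * b,
        6 * b * (u 0 * v 1 - v 0 * u 1) - 2 * (u 1 * v 2 - v 1 * u 2),
        bil u ![-u 1, 3 * b * u 0 + u 2] ![-u 1, 3 * b * u 0 + u 2],
        bil v ![-u 1, 3 * b * u 0 + u 2] ![-u 1, 3 * b * u 0 + u 2],
        bil u ![-v 1, 3 * b * v 0 + v 2] ![-v 1, 3 * b * v 0 + v 2],
        bil v ![-v 1, 3 * b * v 0 + v 2] ![-v 1, 3 * b * v 0 + v 2],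
        bil (cross u v) ![-u 1, 3 * b * u 0 + u 2] ![-u 1, 3 * b * u 0 + u 2],
        bil (cross u v) ![-u 1, 3 * b * u 0 + u 2] ![-v 1, 3 * b * v 0 + v 2],
        bil (cross u v) ![-v 1, 3 * b * v 0 + v 2] ![-v 1, 3 * b * v 0 + v 2],
        bil u ![-u 1, 3 * b * u 0 + u 2] ![18 * b * u 0 + 6 * u 2, -18 * b * u 1],
        bil v ![-u 1, 3 * b * u 0 + u 2] ![18 * b * u 0 + 6 * u 2, -18 * b * u 1],
        bil u ![-v 1, 3 * b * v 0 + v 2] ![18 * b * v 0 + 6 * v 2, -18 * b * v 1],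
        bil v ![-v 1, 3 * b * v 0 + v 2] ![18 * b * v 0 + 6 * v 2, -18 * b * v 1]] := by
  have hh : hess ![0, 1, 0, b] = ![-1, 0, 3 * b] := by
    ext i; fin_cases i <;> simp [hess]
  have hj : jac ![0, 1, 0, b] ![-1, 0, 3 * b] = ![2, 0, 18 * b, 0] := by
    ext i; fin_cases i <;> simp [jac]; ring
  have hl : ∀ q, lin ![0, 1, 0, b] q = ![-q 1, 3 * b * q 0 + q 2] := by
    intro q; ext i; fin_cases i <;> simp [lin]; ring
  have hm : ∀ q, lin ![2, 0, 18 * b, 0] q = ![18 * b * q 0 + 6 * q 2, -18 * b * q 1] := by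
    intro q; ext i; fin_cases i <;> simp [lin] <;> ring
  rw [basicVal, hh, hj]
  simp only [hl, hm]
  ext i
  fin_cases i <;> simp only [Fin.reduceFinMk, Matrix.cons_val] <;>
    simp only [pairing, cross, Matrix.cons_val] <;> ring

theorem relations_basicVal_normal (u v : Fin 3 → B) (b : B) (i : Fin 11) :
    relations (basicVal u v ![0, 1, 0, b]) i = 0 := by
  rw [basicVal_normal]
  fin_cases i <;>
    simp only [relations, Fin.reduceFinMk, Matrix.cons_val, bil, cross] <;> ring

end Relations

theorem relations_basic (i : Fin 11) : relations basic i = 0 := by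
  have hmap : relations basic i =
      aeval basic (relations (X : Fin 18 → MvPolynomial (Fin 18) ℂ) i) := by
    rw [← AlgHom.coe_toRingHom, map_relations]
    congr 1
    ext1 j
    simp
  refine eq_zero_of_eval_normal ?_ fun u v b => ?_
  · rw [hmap, ← basicAlg_eq, basicAlg, Algebra.adjoin_range_eq_range_aeval]
    exact ⟨_, rfl⟩
  · rw [map_relations]
    have : ⇑(eval (point u v ![0, 1, 0, b])) ∘ basic = basicVal u v ![0, 1, 0, b] := by
      ext1 j
      exact eval_basic u v _ j
    rw [this, relations_basicVal_normal]

theorem eq_zero_of_relations {B : Type*} [CommRing B] [Algebra ℂ B] [IsReduced B]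
    (x : Fin 18 → B) (h : ∀ i, relations x i = 0) (h0 : x 0 = 0) (h2 : x 2 = 0)
    (h34 : x 3 + x 4 = 0) (h5 : x 5 = 0) (h7 : x 7 = 0) (h10 : x 10 = 0)
    (h1 : x 1 ^ 3 + x 3 * x 4 = 0) (i : Fin 18) : x i = 0 := by
  have sq : ∀ {a : B} (c : ℂ), c ≠ 0 → ∀ n : ℕ, algebraMap ℂ B c * a ^ n = 0 → a = 0 := by
    intro a c hc n hn
    refine IsReduced.eq_zero _ ⟨n, ?_⟩
    rw [← one_mul (a ^ n), ← map_one (algebraMap ℂ B), ← inv_mul_cancel₀ hc, map_mul, mul_assoc,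
      hn, mul_zero]
  have h4 : x 4 = -x 3 := by linear_combination h34
  have r : ∀ i, relations x i = 0 := h
  have r0 := r 0
  have r1 := r 1
  have r2 := r 2
  have r3 := r 3
  have r4 := r 4
  have r5 := r 5
  have r6 := r 6
  have r7 := r 7
  have r8 := r 8
  have r9 := r 9
  have r10 := r 10
  simp only [relations, Matrix.cons_val, h0, h2, h5, h7, h10, h4] at r0 r1 r2 r3 r4 r5 r6
  simp only [relations, Matrix.cons_val, h0, h2, h5, h7, h10, h4] at r7 r8 r9 r10
  rw [h4] at h1
  have e8 : 2 * x 8 + x 1 * x 3 = 0 := sq 1 one_ne_zero 2 (by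
    rw [map_one]; linear_combination r1)
  have e9 : 2 * x 9 - x 1 * x 3 = 0 := sq 1 one_ne_zero 2 (by
    rw [map_one]; linear_combination r2)
  have e13 : x 1 * x 3 = 0 := sq 3 three_ne_zero 2 (by
    rw [map_ofNat]
    linear_combination -2 * r3 + 2 * x 9 * e8 - x 1 * x 3 * e9 + 2 * x 1 * x 3 * e9
      - 2 * x 1 * x 3 * e8)
  have e1 : x 1 = 0 := sq 1 one_ne_zero 4 (by
    rw [map_one]; linear_combination x 1 * h1 + x 3 * e13)
  have e3 : x 3 = 0 := sq 1 one_ne_zero 2 (by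
    rw [map_one]; linear_combination -h1 + x 1 ^ 2 * e1)
  rw [e1] at e8 e9
  have e8' : x 8 = 0 := sq 2 two_ne_zero 1 (by rw [map_ofNat]; linear_combination e8)
  have e9' : x 9 = 0 := sq 2 two_ne_zero 1 (by rw [map_ofNat]; linear_combination e9)
  simp only [e1, e3, e8', e9'] at r0 r4 r5 r6 r7 r8 r9 r10
  have e6 : x 6 = 0 := sq 1 one_ne_zero 2 (by rw [map_one]; linear_combination r0)
  rw [e6] at r4 r5 r6
  have e11 : x 11 = 0 := sq 4 (by norm_num) 2 (by rw [map_ofNat]; linear_combination r4)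
  have e12 : x 12 = 0 := sq 4 (by norm_num) 2 (by rw [map_ofNat]; linear_combination r5)
  have e13' : x 13 = 0 := sq 4 (by norm_num) 2 (by rw [map_ofNat]; linear_combination r6)
  have e14 : x 14 = 0 := sq 4 (by norm_num) 2 (by rw [map_ofNat]; linear_combination r7)
  have e15 : x 15 = 0 := sq 4 (by norm_num) 2 (by rw [map_ofNat]; linear_combination r8)
  have e16 : x 16 = 0 := sq 4 (by norm_num) 2 (by rw [map_ofNat]; linear_combination r9)
  have e17 : x 17 = 0 := sq 4 (by norm_num) 2 (by rw [map_ofNat]; linear_combination r10)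
  have e4 : x 4 = 0 := by rw [h4, e3, neg_zero]
  fin_cases i <;> assumption

/-! ### Integrality over the parameters -/

theorem homogeneousComponent_mul_right {σ R : Type*} [CommSemiring R] {p : MvPolynomial σ R}
    {e : ℕ} (hp : p.IsHomogeneous e) (q : MvPolynomial σ R) (d : ℕ) :
    ∃ n, homogeneousComponent d (q * p) =
      (if e ≤ d then homogeneousComponent n q else 0) * p ∧ n + e = max d e := by
  have key : homogeneousComponent d (q * p) =
      ∑ k ∈ Finset.range (q.totalDegree + 1),
        if d = k + e then homogeneousComponent k q * p else 0 := by
    conv_lhs => rw [← sum_homogeneousComponent q, Finset.sum_mul, map_sum]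
    exact Finset.sum_congr rfl fun k _ => homogeneousComponent_of_mem
      ((homogeneousComponent_isHomogeneous k q).mul hp)
  refine ⟨d - e, ?_, by omega⟩
  rw [key]
  split_ifs with h
  · have : ∀ k, (d = k + e) ↔ d - e = k := fun k => by omega
    simp only [this, Finset.sum_ite_eq, Finset.mem_range]
    split_ifs with h'
    · rfl
    · rw [homogeneousComponent_eq_zero _ _ (by omega), zero_mul]
  · rw [zero_mul]
    exact Finset.sum_eq_zero fun k _ => if_neg (by omega)

/-- The parameters, of degrees `2, 2, 3, 4, 5, 5, 6`. -/
noncomputable def params : Fin 7 → Poly :=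
  ![basic 0, basic 2, basic 3 + basic 4, basic 5, basic 7, basic 10,
    basic 1 ^ 3 + basic 3 * basic 4]

theorem params_mem (j : Fin 7) : params j ∈ Inv := by
  have h := basic_mem
  fin_cases j <;> simp only [params, Fin.reduceFinMk, Matrix.cons_val]
  · exact h 0
  · exact h 2
  · exact add_mem (h 3) (h 4)
  · exact h 5
  · exact h 7
  · exact h 10
  · exact add_mem (pow_mem (h 1) 3) (mul_mem (h 3) (h 4))

theorem params_isHomogeneous (j : Fin 7) :
    (params j).IsHomogeneous (![2, 2, 3, 4, 5, 5, 6] j) := by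
  have h := basic_isHomogeneous
  fin_cases j <;> simp only [params, Fin.reduceFinMk, Matrix.cons_val]
  · exact h 0
  · exact h 2
  · exact (h 3).add (h 4)
  · exact h 5
  · exact h 7
  · exact h 10
  · exact ((h 1).pow 3).add ((h 3).mul (h 4))

theorem exists_basic_pow_eq (i : Fin 18) : ∃ N : ℕ, ∃ c : Fin 7 → Poly,
    (∀ j, c j ∈ Inv) ∧ basic i ^ N = ∑ j, c j * params j := by
  let g : Fin 18 → Inv := fun i => ⟨basic i, basic_mem i⟩
  let P : Fin 7 → Inv := fun j => ⟨params j, params_mem j⟩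
  let I : Ideal Inv := Ideal.span (Set.range P)
  have hP : ∀ j, Ideal.Quotient.mk I.radical (P j) = 0 := fun j =>
    Ideal.Quotient.eq_zero_iff_mem.2 (Ideal.le_radical (Ideal.subset_span ⟨j, rfl⟩))
  have : IsReduced (Inv ⧸ I.radical) :=
    (Ideal.isRadical_iff_quotient_reduced _).1 (Ideal.radical_isRadical _)
  have hrel : ∀ k, relations g k = 0 := fun k => by
    apply Subtype.val_injective
    have := map_relations (Subalgebra.val Inv : Inv →+* Poly) g k
    exact this.trans (relations_basic k)
  have hP' : ∀ (x : Inv) (j : Fin 7), (x : Poly) = params j →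
      Ideal.Quotient.mk I.radical x = 0 := fun x j h => by
    rw [← hP j]; exact congrArg _ (Subtype.ext h)
  have hg : Ideal.Quotient.mk I.radical (g i) = 0 := by
    refine eq_zero_of_relations (fun i => Ideal.Quotient.mk I.radical (g i)) (fun k => ?_)
      (hP' _ 0 ?_) (hP' _ 1 ?_) ?_ (hP' _ 3 ?_) (hP' _ 4 ?_) (hP' _ 5 ?_) ?_ i
    · have := map_relations (B' := Inv ⧸ I.radical) (Ideal.Quotient.mk I.radical) g k
      rw [hrel, map_zero] at this
      exact this.symm
    · simp only [params, Matrix.cons_val, g]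
    · simp only [params, Matrix.cons_val, g]
    · rw [← map_add]
      refine hP' _ 2 ?_
      simp only [params, Matrix.cons_val, g]
      rfl
    · simp only [params, Matrix.cons_val, g]
    · simp only [params, Matrix.cons_val, g]
    · simp only [params, Matrix.cons_val, g]
    · rw [← map_pow, ← map_mul, ← map_add]
      refine hP' _ 6 ?_
      simp only [params, Matrix.cons_val, g]
      rfl
  obtain ⟨N, hN⟩ := Ideal.Quotient.eq_zero_iff_mem.1 hg
  obtain ⟨c, hc⟩ := Ideal.mem_span_range_iff_exists_fun.1 hN
  refine ⟨N, fun j => c j, fun j => (c j).2, ?_⟩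
  have := congrArg (Subalgebra.val Inv) hc
  rw [map_sum] at this
  exact this.symm

/-- The subalgebra generated by the parameters. -/
noncomputable abbrev paramAlg : Subalgebra ℂ Poly := Algebra.adjoin ℂ (Set.range params)

theorem paramAlg_le : paramAlg ≤ Inv :=
  Algebra.adjoin_le (Set.range_subset_iff.2 params_mem)

theorem exists_finite_span : ∃ T : Set Poly, T.Finite ∧ T ⊆ Inv ∧
    ∀ P ∈ Inv, P ∈ Submodule.span paramAlg T := by
  choose N c hc hN using exists_basic_pow_eq
  refine ⟨Set.range fun m : ∀ i, Fin (N i) => ∏ i, basic i ^ (m i : ℕ), Set.finite_range _,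
    Set.range_subset_iff.2 fun m => prod_mem fun i _ => pow_mem (basic_mem i) _, ?_⟩
  set T := Set.range fun m : ∀ i, Fin (N i) => ∏ i, basic i ^ (m i : ℕ)
  have smul_mem : ∀ (a : ℂ) (Q : Poly), Q ∈ Submodule.span paramAlg T →
      C a * Q ∈ Submodule.span paramAlg T := fun a Q hQ =>
    Submodule.smul_mem _ (⟨C a, paramAlg.algebraMap_mem a⟩ : paramAlg) hQ
  have hom : ∀ d, ∀ P ∈ Inv, P.IsHomogeneous d → P ∈ Submodule.span paramAlg T := by
    intro d
    induction d using Nat.strong_induction_on with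
    | _ d ih =>
      have mon : ∀ s : Fin 18 → ℕ,
          homogeneousComponent d (∏ i, basic i ^ s i) ∈ Submodule.span paramAlg T := by
        intro s
        have hs := IsHomogeneous.prod Finset.univ _ _ fun i _ =>
          (basic_isHomogeneous i).pow (s i)
        by_cases hlt : ∀ i, s i < N i
        · rw [homogeneousComponent_of_mem hs]
          split_ifs
          · exact Submodule.subset_span ⟨fun i => ⟨s i, hlt i⟩, rfl⟩
          · exact zero_mem _
        · push Not at hlt
          obtain ⟨i, hi⟩ := hlt
          have e : ∏ k, basic k ^ s k =
              ∑ j, (c i j * (basic i ^ (s i - N i) *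
                ∏ k ∈ Finset.univ.erase i, basic k ^ s k)) * params j := by
            rw [← Finset.mul_prod_erase _ _ (Finset.mem_univ i), ← Nat.sub_add_cancel hi, pow_add,
              hN, Nat.add_sub_cancel, Finset.mul_sum, Finset.sum_mul]
            exact Finset.sum_congr rfl fun j _ => by ring
          rw [e, map_sum]
          refine sum_mem fun j _ => ?_
          obtain ⟨n, hn, hnd⟩ := homogeneousComponent_mul_right (params_isHomogeneous j)
            (c i j * (basic i ^ (s i - N i) * ∏ k ∈ Finset.univ.erase i, basic k ^ s k)) d
          rw [hn]
          split_ifs with hle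
          · have hpos : 0 < (![2, 2, 3, 4, 5, 5, 6] : Fin 7 → ℕ) j := by fin_cases j <;> simp
            rw [mul_comm]
            refine Submodule.smul_mem _
              (⟨params j, Algebra.subset_adjoin ⟨j, rfl⟩⟩ : paramAlg) ?_
            refine ih n (by omega) _ ?_ (homogeneousComponent_isHomogeneous n _)
            rw [homogeneousComponent, ← blockWeight_one]
            exact component_mem (mul_mem (hc i j) (mul_mem (pow_mem (basic_mem i) _)
              (prod_mem fun k _ => pow_mem (basic_mem k) _))) _ n
          · rw [zero_mul]; exact zero_mem _
      intro P hP hd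
      rw [← basicAlg_eq, basicAlg, Algebra.adjoin_range_eq_range_aeval] at hP
      obtain ⟨q, rfl⟩ := hP
      rw [← homogeneousComponent_eq_self hd]
      change homogeneousComponent d (aeval basic q) ∈ _
      rw [aeval_def, eval₂_eq', map_sum]
      refine sum_mem fun s _ => ?_
      rw [algebraMap_eq, homogeneousComponent_C_mul]
      exact smul_mem _ _ (mon s)
  intro P hP
  rw [← sum_homogeneousComponent P]
  refine sum_mem fun k _ => hom k _ ?_ (homogeneousComponent_isHomogeneous k P)
  rw [homogeneousComponent, ← blockWeight_one]
  exact component_mem hP _ k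

theorem isIntegral_paramAlg {x : Poly} (hx : x ∈ Inv) : IsIntegral paramAlg x := by
  obtain ⟨T, hT, hTI, hspan⟩ := exists_finite_span
  let S : Subalgebra paramAlg Poly :=
    { Inv.toSubsemiring with algebraMap_mem' := fun a => paramAlg_le a.2 }
  refine IsIntegral.of_mem_of_fg S ?_ x hx
  have : Subalgebra.toSubmodule S = Submodule.span paramAlg T :=
    le_antisymm (fun y hy => hspan y hy) (Submodule.span_le.2 hTI)
  rw [this]
  exact Submodule.fg_span hT

/-! ### Algebraic independence of the parameters -/

theorem algebraicIndependent_of_isAlgebraic_adjoin {ι K A : Type*} [Fintype ι] [Field K]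
    [CommRing A] [IsDomain A] [Algebra K A] {x y : ι → A} (hy : AlgebraicIndependent K y)
    (h : ∀ i, IsAlgebraic (Algebra.adjoin K (Set.range x)) (y i)) :
    AlgebraicIndependent K x := by
  let M := AlgebraicIndependent.matroid K A
  have hrk : (Fintype.card ι : ℕ∞) ≤ M.eRk (Set.range x) := by
    have hI : M.Indep (Set.range y) := hy.to_subtype_range
    have hsub : Set.range y ⊆ M.closure (Set.range x) := by
      rw [AlgebraicIndependent.matroid_closure_eq]
      rintro _ ⟨i, rfl⟩
      exact h i
    calc (Fintype.card ι : ℕ∞) = (Set.range y).encard := by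
          rw [← Set.image_univ, hy.injective.encard_image, Set.encard_univ,
            ENat.card_eq_coe_fintype_card]
      _ = M.eRk (Set.range y) := hI.eRk_eq_encard.symm
      _ ≤ M.eRk (M.closure (Set.range x)) := M.eRk_mono hsub
      _ = M.eRk (Set.range x) := M.eRk_closure_eq _
  have hle : (Set.range x).encard ≤ Fintype.card ι := by
    rw [← Set.image_univ]
    refine (Set.encard_image_le _ _).trans ?_
    rw [Set.encard_univ, ENat.card_eq_coe_fintype_card]
  have hcard : (Set.range x).encard = Fintype.card ι :=
    hle.antisymm (hrk.trans (M.eRk_le_encard _))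
  have hinj : Function.Injective x := by
    have : Set.InjOn x Set.univ := by
      refine Set.finite_univ.injOn_of_encard_image_eq ?_
      rw [Set.image_univ, hcard, Set.encard_univ, ENat.card_eq_coe_fintype_card]
    exact Set.injOn_univ.1 this
  have hX : M.Indep (Set.range x) :=
    (M.indep_iff_eRk_eq_encard_of_finite (Set.finite_range x)).2
      ((M.eRk_le_encard _).antisymm (hle.trans hrk))
  exact (algebraicIndependent_subtype_range hinj).1 hX

theorem exists_quadratic_eq {b : ℂ} (hb : b ≠ 0) (A h F : ℂ) : ∃ u : Fin 3 → ℂ,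
    4 * u 0 * u 2 - u 1 ^ 2 = A ∧ 6 * b * u 0 - 2 * u 2 = h ∧
      bil u ![-u 1, 3 * b * u 0 + u 2] ![-u 1, 3 * b * u 0 + u 2] = F := by
  let P : Cubic ℂ := ⟨288 * b ^ 2, -72 * b * h, 9 / 2 * h ^ 2 - 18 * b * A, 2 * A * h - F⟩
  have hP : P.a ≠ 0 := mul_ne_zero (by norm_num) (pow_ne_zero 2 hb)
  obtain ⟨a, ha⟩ := IsAlgClosed.exists_root P.toPoly
    (by rw [Cubic.degree_of_a_ne_zero hP]; norm_num)
  have ha' : 288 * b ^ 2 * a ^ 3 + -72 * b * h * a ^ 2 + (9 / 2 * h ^ 2 - 18 * b * A) * a +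
      (2 * A * h - F) = 0 := by
    simpa [Polynomial.IsRoot, Cubic.toPoly, P] using ha
  obtain ⟨s, hs⟩ := IsAlgClosed.exists_pow_nat_eq (4 * a * (3 * b * a - h / 2) - A) two_pos
  refine ⟨![a, s, 3 * b * a - h / 2], ?_, ?_, ?_⟩ <;> simp only [bil, Matrix.cons_val]
  · linear_combination -hs
  · ring
  · linear_combination ha' + 2 * (9 * b * a - h) * hs

theorem algebraicIndependent_basic :
    AlgebraicIndependent ℂ
      ![basic 5, basic 3, basic 0, basic 7, basic 4, basic 2, basic 10] := by
  rw [algebraicIndependent_iff]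
  intro Q hQ
  suffices Q * X 0 = 0 from (mul_eq_zero.1 this).resolve_right (X_ne_zero 0)
  refine MvPolynomial.funext fun z => ?_
  rw [map_mul, eval_X, map_zero]
  by_cases hz : z 0 = 0
  · rw [hz, mul_zero]
  have hb : -z 0 / 12 ≠ 0 := div_ne_zero (neg_ne_zero.2 hz) (by norm_num)
  obtain ⟨u, hu1, hu2, hu3⟩ := exists_quadratic_eq hb (z 2) (z 1) (z 3)
  obtain ⟨v, hv1, hv2, hv3⟩ := exists_quadratic_eq hb (z 5) (z 4) (z 6)
  have hzv : z = fun j => eval (point u v ![0, 1, 0, -z 0 / 12])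
      (![basic 5, basic 3, basic 0, basic 7, basic 4, basic 2, basic 10] j) := by
    ext j
    fin_cases j <;> simp only [Fin.reduceFinMk, Fin.zero_eta, Matrix.cons_val, eval_basic] <;>
      rw [basicVal_normal] <;> simp only [Matrix.cons_val]
    · ring
    · exact hu2.symm
    · exact hu1.symm
    · exact hu3.symm
    · exact hv2.symm
    · exact hv1.symm
    · exact hv3.symm
  have : eval z Q = 0 := by
    have := congrArg (aeval (point u v ![0, 1, 0, -z 0 / 12])) hQ
    rw [map_zero, comp_aeval_apply] at this
    rw [hzv, eval_eq_aeval]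
    simpa only [← eval_eq_aeval] using this
  rw [this, zero_mul]

theorem algebraicIndependent_params : AlgebraicIndependent ℂ params := by
  refine algebraicIndependent_of_isAlgebraic_adjoin algebraicIndependent_basic fun i => ?_
  have h : ∀ j, IsAlgebraic paramAlg (basic j) := fun j =>
    (isIntegral_paramAlg (basic_mem j)).isAlgebraic
  fin_cases i <;> simp only [Fin.reduceFinMk, Fin.zero_eta, Matrix.cons_val]
  exacts [h 5, h 3, h 0, h 7, h 4, h 2, h 10]

/-! ### Minimality of the basic invariants -/

/-- A linear functional that is a derivation at the origin on the algebra of invariants. -/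
def IsPointDerivation (ψ : Poly →ₗ[ℂ] ℂ) : Prop :=
  ψ 1 = 0 ∧ ∀ P ∈ Inv, ∀ Q ∈ Inv, ψ (P * Q) = eval 0 P * ψ Q + eval 0 Q * ψ P

/-- The value vectors of point derivations on the basic invariants. -/
noncomputable def derivationValues : Submodule ℂ (Fin 18 → ℂ) where
  carrier := {c | ∃ ψ, IsPointDerivation ψ ∧ ∀ i, ψ (basic i) = c i}
  add_mem' := by
    rintro c d ⟨ψ, ⟨h1, h2⟩, hc⟩ ⟨χ, ⟨k1, k2⟩, hd⟩
    refine ⟨ψ + χ, ⟨?_, fun P hP Q hQ => ?_⟩, fun i => ?_⟩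
    · rw [LinearMap.add_apply, h1, k1, add_zero]
    · rw [LinearMap.add_apply, h2 P hP Q hQ, k2 P hP Q hQ, LinearMap.add_apply,
        LinearMap.add_apply]
      ring
    · rw [LinearMap.add_apply, hc, hd, Pi.add_apply]
  zero_mem' := ⟨0, ⟨rfl, fun P _ Q _ => by simp⟩, fun i => rfl⟩
  smul_mem' := by
    rintro a c ⟨ψ, ⟨h1, h2⟩, hc⟩
    refine ⟨a • ψ, ⟨?_, fun P hP Q hQ => ?_⟩, fun i => ?_⟩
    · rw [LinearMap.smul_apply, h1, smul_zero]
    · rw [LinearMap.smul_apply, h2 P hP Q hQ, LinearMap.smul_apply, LinearMap.smul_apply]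
      simp only [smul_eq_mul]
      ring
    · rw [LinearMap.smul_apply, hc, Pi.smul_apply]

theorem eval_zero_basic (i : Fin 18) : eval 0 (basic i) = 0 := by
  have h : (0 : Idx ![2, 2, 3] → ℂ) = point 0 0 0 := eq_point 0
  rw [h, eval_basic]
  fin_cases i <;> simp [basicVal, pairing, hess, cross, jac, lin, bil]

open Polynomial in
theorem mem_derivationValues {u v : Fin 3 → ℂ[X]} {f : Fin 4 → ℂ[X]} {c : Fin 18 → ℂ}
    (a b : Fin 18 → ℂ) (r : Fin 18 → ℂ[X])
    (h : ∀ i, basicVal u v f i =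
      Polynomial.C (a i) * Polynomial.X ^ 2 + Polynomial.C (b i) * Polynomial.X ^ 4 +
        Polynomial.C (c i) * Polynomial.X ^ 5 + r i * Polynomial.X ^ 6) :
    c ∈ derivationValues := by
  let ev : Poly →ₐ[ℂ] ℂ[X] := MvPolynomial.aeval (point u v f)
  have hev : ∀ i, ev (basic i) = _ := fun i => (aeval_basic u v f i).trans (h i)
  have key : ∀ P ∈ Inv, (ev P).coeff 0 = eval 0 P ∧ (ev P).coeff 1 = 0 ∧
      (ev P).coeff 3 = 0 := by
    intro P hP
    rw [← basicAlg_eq] at hP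
    induction hP using Algebra.adjoin_induction with
    | mem P hP =>
      obtain ⟨i, rfl⟩ := hP
      rw [hev, eval_zero_basic]
      simp [Polynomial.coeff_X_pow, Polynomial.coeff_mul_X_pow']
    | algebraMap z =>
      rw [AlgHom.commutes, Polynomial.algebraMap_apply, MvPolynomial.algebraMap_eq,
        MvPolynomial.eval_C]
      simp [Polynomial.coeff_C]
    | add P Q _ _ hP hQ => simp [hP, hQ]
    | mul P Q _ _ hP hQ =>
      simp [hP, hQ, Polynomial.coeff_mul, Finset.Nat.antidiagonal_succ]
  refine ⟨Polynomial.lcoeff ℂ 5 ∘ₗ ev.toLinearMap, ⟨?_, fun P hP Q hQ => ?_⟩, fun i => ?_⟩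
  · simp [Polynomial.coeff_one]
  · obtain ⟨hP0, hP1, hP3⟩ := key P hP
    obtain ⟨hQ0, hQ1, hQ3⟩ := key Q hQ
    simp [hP0, hP1, hP3, hQ0, hQ1, hQ3, Polynomial.coeff_mul, Finset.Nat.antidiagonal_succ]
    ring
  · rw [LinearMap.comp_apply, AlgHom.toLinearMap_apply, hev]
    simp [Polynomial.coeff_mul_X_pow']

theorem pairing_values_mem (a a' b b' : ℂ) :
    ![4 * a * a', 2 * (a * b' + b * a'), 4 * b * b', 0, 0, 0, 0, 0, 0, 0, 0, 0, 0, 0, 0, 0, 0, 0]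
      ∈ derivationValues := by
  refine mem_derivationValues
    (u := ![Polynomial.C a * Polynomial.X ^ 2, 0, Polynomial.C a' * Polynomial.X ^ 3])
    (v := ![Polynomial.C b * Polynomial.X ^ 2, 0, Polynomial.C b' * Polynomial.X ^ 3])
    (f := 0) 0 0 0 fun i => ?_
  fin_cases i <;>
    simp only [basicVal, pairing, hess, cross, jac, lin, bil, Fin.reduceFinMk, Fin.zero_eta,
      Fin.mk_one, Matrix.cons_val, Pi.zero_apply, map_mul, map_add,
      map_zero, map_ofNat (Polynomial.C : ℂ →+* _)] <;>
    ring

theorem hess_values_mem (a b d : ℂ) :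
    ![0, 0, 0, -2 * a, -2 * b, -12 * d, 0, 0, 0, 0, 0, 0, 0, 0, 0, 0, 0, 0]
      ∈ derivationValues := by
  refine mem_derivationValues
    (u := ![0, 0, Polynomial.C a * Polynomial.X ^ 5])
    (v := ![0, 0, Polynomial.C b * Polynomial.X ^ 5])
    (f := ![0, 1, 0, Polynomial.C d * Polynomial.X ^ 5]) 0 0 0 fun i => ?_
  fin_cases i <;>
    simp only [basicVal, pairing, hess, cross, jac, lin, bil, Fin.reduceFinMk, Fin.zero_eta,
      Fin.mk_one, Matrix.cons_val, Pi.zero_apply, map_mul, map_neg,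
      map_zero, map_ofNat (Polynomial.C : ℂ →+* _)] <;>
    ring

theorem cross_hess_values_mem :
    ![0, 0, 0, 0, 0, 0, -2, 0, 0, 0, 0, 0, 0, 0, 0, 0, 0, 0] ∈ derivationValues := by
  refine mem_derivationValues (u := ![0, Polynomial.X ^ 3, 0]) (v := ![0, 0, 1])
    (f := ![0, Polynomial.X, 0, 0]) ![0, 0, 0, 0, -2, 0, 0, 0, 0, 0, 0, 0, 0, 0, 0, 0, 0, 0] 0
    ![-1, 0, 0, 0, 0, 0, 0, 0, 2 * Polynomial.X ^ 2, 0, 0, 2 * Polynomial.X ^ 5, 0, 0, 0, 0,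
      -6 * Polynomial.X, 0] fun i => ?_
  fin_cases i <;>
    simp only [basicVal, pairing, hess, cross, jac, lin, bil, Fin.reduceFinMk, Fin.zero_eta,
      Fin.mk_one, Matrix.cons_val, Pi.zero_apply, map_neg,
      map_zero, map_ofNat (Polynomial.C : ℂ →+* _)] <;>
    ring

theorem quintic_values_mem (a a' b b' : ℂ) :
    ![0, 0, 0, 0, 0, 0, 0, 54 * a ^ 2 * a', 18 * (a ^ 2 * b' + 2 * a * a' * b),
      18 * (b ^ 2 * a' + 2 * b * b' * a), 54 * b ^ 2 * b', 0, 0, 0, 0, 0, 0, 0]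
      ∈ derivationValues := by
  let A := Polynomial.C a
  let A' := Polynomial.C a'
  let B := Polynomial.C b
  let B' := Polynomial.C b'
  refine mem_derivationValues
    (u := ![0, 0, A + A' * Polynomial.X ^ 3])
    (v := ![0, 0, B + B' * Polynomial.X ^ 3])
    (f := ![Polynomial.X, 0, 0, 0])
    ![0, 0, 0, 0, 0, 0, 0, 18 * a ^ 3, 18 * a ^ 2 * b, 18 * a * b ^ 2, 18 * b ^ 3,
      0, 0, 0, 0, 0, 0, 0] 0
    ![0, 0, 0, 0, 0, 0, 0,
      54 * A * A' ^ 2 * Polynomial.X ^ 2 + 18 * A' ^ 3 * Polynomial.X ^ 5,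
      18 * (2 * A * A' * B' + A' ^ 2 * B) * Polynomial.X ^ 2 +
        18 * A' ^ 2 * B' * Polynomial.X ^ 5,
      18 * (2 * B * B' * A' + B' ^ 2 * A) * Polynomial.X ^ 2 +
        18 * B' ^ 2 * A' * Polynomial.X ^ 5,
      54 * B * B' ^ 2 * Polynomial.X ^ 2 + 18 * B' ^ 3 * Polynomial.X ^ 5,
      0, 0, 0, 0, 0, 0, 0] fun i => ?_
  fin_cases i <;>
    simp only [basicVal, pairing, hess, cross, jac, lin, bil, Fin.reduceFinMk, Fin.zero_eta,
      Fin.mk_one, Matrix.cons_val, Pi.zero_apply, map_mul, map_add, map_pow,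
      map_zero, map_ofNat (Polynomial.C : ℂ →+* _), A, A', B, B'] <;>
    ring

theorem sextic_values_mem (a b α β : ℂ) :
    ![0, 0, 0, 0, 0, 0, 0, 0, 0, 0, 0, 18 * a ^ 2 * (α * b - β * a),
      18 * a * b * (α * b - β * a), 18 * b ^ 2 * (α * b - β * a), 0, 0, 0, 0]
      ∈ derivationValues := by
  refine mem_derivationValues
    (u := ![0, Polynomial.C α * Polynomial.X ^ 3, Polynomial.C a])
    (v := ![0, Polynomial.C β * Polynomial.X ^ 3, Polynomial.C b])
    (f := ![Polynomial.X, 0, 0, 0])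
    ![0, 0, 0, 0, 0, 0, 0, 18 * a ^ 3, 18 * a ^ 2 * b, 18 * a * b ^ 2, 18 * b ^ 3,
      0, 0, 0, 0, 0, 0, 0] 0
    ![-Polynomial.C (α ^ 2), -Polynomial.C (α * β), -Polynomial.C (β ^ 2),
      0, 0, 0, 0, 0, 0, 0, 0, 0, 0, 0, 0, 0, 0, 0] fun i => ?_
  fin_cases i <;>
    simp only [basicVal, pairing, hess, cross, jac, lin, bil, Fin.reduceFinMk, Fin.zero_eta,
      Fin.mk_one, Matrix.cons_val, Pi.zero_apply, map_mul, map_sub, map_pow,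
      map_zero, map_ofNat (Polynomial.C : ℂ →+* _)] <;>
    ring

theorem septic_values_mem (a b : ℂ) :
    ![0, 0, 0, 0, 0, 0, 0, 0, 0, 0, 0, 0, 0, 0,
      -18 * a ^ 3, -18 * a ^ 2 * b, -18 * a * b ^ 2, -18 * b ^ 3] ∈ derivationValues := by
  refine mem_derivationValues
    (u := ![0, Polynomial.C a * Polynomial.X, Polynomial.C a])
    (v := ![0, Polynomial.C b * Polynomial.X, Polynomial.C b])
    (f := ![0, Polynomial.X, 0, 0])
    ![-a ^ 2, -a * b, -b ^ 2, -2 * a, -2 * b, 0, 0, 0, 0, 0, 0, 0, 0, 0, 0, 0, 0, 0]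
    ![0, 0, 0, 0, 0, 0, 0, 4 * a ^ 3, 4 * a ^ 2 * b, 4 * a * b ^ 2, 4 * b ^ 3,
      0, 0, 0, 0, 0, 0, 0] 0 fun i => ?_
  fin_cases i <;>
    simp only [basicVal, pairing, hess, cross, jac, lin, bil, Fin.reduceFinMk, Fin.zero_eta,
      Fin.mk_one, Matrix.cons_val, Pi.zero_apply, map_mul, map_neg, map_pow,
      map_zero, map_ofNat (Polynomial.C : ℂ →+* _)] <;>
    ring

theorem derivationValues_eq_top : derivationValues = ⊤ := by
  refine eq_top_iff.2 fun c _ => ?_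
  have hs : ∀ (a : ℂ) {d}, d ∈ derivationValues → a • d ∈ derivationValues := fun a _ hd =>
    derivationValues.smul_mem a hd
  have h2 := add_mem (add_mem (hs (c 0 / 4) (pairing_values_mem 1 1 0 0))
    (hs (c 1 / 2) (pairing_values_mem 1 0 0 1))) (hs (c 2 / 4) (pairing_values_mem 0 0 1 1))
  have h4 := add_mem (hess_values_mem (-c 3 / 2) (-c 4 / 2) (-c 5 / 12))
    (hs (-c 6 / 2) cross_hess_values_mem)
  have h5 := add_mem (add_mem (hs (c 7 / 54) (quintic_values_mem 1 1 0 0))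
    (hs (c 8 / 18) (quintic_values_mem 1 0 0 1))) (add_mem
    (hs (c 9 / 18) (quintic_values_mem 0 1 1 0)) (hs (c 10 / 54) (quintic_values_mem 0 0 1 1)))
  have h6 := add_mem (add_mem (hs ((c 11 - c 12) / 18) (sextic_values_mem 1 0 0 (-1)))
    (hs (c 12 / 18) (sextic_values_mem 1 1 1 0)))
    (hs ((c 13 - c 12) / 18) (sextic_values_mem 0 1 1 0))
  have h7 := add_mem (add_mem (hs ((c 16 - c 14) / 18) (septic_values_mem 1 0))
    (hs ((c 15 - c 17) / 18) (septic_values_mem 0 1))) (add_mem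
    (hs (-(c 15 + c 16) / 36) (septic_values_mem 1 1))
    (hs ((c 15 - c 16) / 36) (septic_values_mem 1 (-1))))
  convert add_mem (add_mem (add_mem h2 h4) (add_mem h5 h6)) h7 using 1
  ext i
  fin_cases i <;> simp only [Pi.add_apply, Pi.smul_apply, smul_eq_mul, Fin.reduceFinMk,
    Fin.zero_eta, Fin.mk_one, Matrix.cons_val] <;> ring

theorem exists_dual_derivations : ∃ Ψ : Poly →ₗ[ℂ] (Fin 18 → ℂ), Ψ 1 = 0 ∧
    (∀ P ∈ Inv, ∀ Q ∈ Inv, Ψ (P * Q) = eval 0 P • Ψ Q + eval 0 Q • Ψ P) ∧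
    ∀ i, Ψ (basic i) = Pi.single i 1 := by
  have h : ∀ i : Fin 18, ∃ ψ, IsPointDerivation ψ ∧
      ∀ j, ψ (basic j) = (Pi.single i 1 : Fin 18 → ℂ) j := fun i => by
    have : (Pi.single i 1 : Fin 18 → ℂ) ∈ derivationValues := by
      rw [derivationValues_eq_top]
      trivial
    exact this
  choose ψ hψ hb using h
  refine ⟨LinearMap.pi ψ, ?_, fun P hP Q hQ => ?_, fun j => ?_⟩
  · ext i
    exact (hψ i).1
  · ext i
    exact (hψ i).2 P hP Q hQ
  · ext i
    exact (hb i j).trans (Pi.single_comm i 1 j)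

theorem basic_injective : Function.Injective basic := by
  obtain ⟨Ψ, -, -, hb⟩ := exists_dual_derivations
  intro i j hij
  have h : (Pi.single i 1 : Fin 18 → ℂ) i = (Pi.single j 1 : Fin 18 → ℂ) i := by
    rw [← hb, ← hb, hij]
  by_contra hne
  rw [Pi.single_eq_same, Pi.single_eq_of_ne hne] at h
  exact one_ne_zero h

open Classical in
theorem le_card_of_adjoin_eq (S : Finset Poly)
    (hS : Algebra.adjoin ℂ (S : Set Poly) = Inv) : 18 ≤ S.card := by
  obtain ⟨Ψ, h1, hmul, hb⟩ := exists_dual_derivations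
  let T : Submodule ℂ (Fin 18 → ℂ) := Submodule.span ℂ (S.image Ψ : Finset (Fin 18 → ℂ))
  have hT : ∀ P ∈ Algebra.adjoin ℂ (S : Set Poly), Ψ P ∈ T := by
    intro P hP
    induction hP using Algebra.adjoin_induction with
    | mem P hP => exact Submodule.subset_span (Finset.mem_coe.2 (Finset.mem_image_of_mem Ψ hP))
    | algebraMap z =>
      rw [Algebra.algebraMap_eq_smul_one, map_smul, h1, smul_zero]
      exact T.zero_mem
    | add P Q _ _ hP hQ =>
      rw [map_add]
      exact T.add_mem hP hQ
    | mul P Q hP' hQ' hP hQ =>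
      rw [hmul P (hS ▸ hP') Q (hS ▸ hQ')]
      exact T.add_mem (T.smul_mem _ hQ) (T.smul_mem _ hP)
  have htop : T = ⊤ := by
    rw [eq_top_iff, ← (Pi.basisFun ℂ (Fin 18)).span_eq, Submodule.span_le]
    rintro _ ⟨i, rfl⟩
    rw [Pi.basisFun_apply, ← hb]
    exact hT _ (hS ▸ basic_mem i)
  calc 18 = Module.finrank ℂ T := by
        rw [htop, finrank_top, Module.finrank_fin_fun]
    _ ≤ (S.image Ψ).card := finrank_span_finset_le_card _
    _ ≤ S.card := Finset.card_image_le

theorem hasMinimalGens : HasMinimalGens ![2, 2, 3]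
    ![2, 2, 2, 3, 3, 4, 4, 5, 5, 5, 5, 6, 6, 6, 7, 7, 7, 7] := by
  classical
  refine ⟨⟨⟨Finset.univ.image basic, ?_, ?_⟩, ?_⟩, basic, basic_injective, fun j => ?_,
    basicAlg_eq⟩
  · rw [Finset.card_image_of_injective _ basic_injective, Finset.card_univ, Fintype.card_fin]
  · rw [Finset.coe_image, Finset.coe_univ, Set.image_univ]
    exact basicAlg_eq
  · rintro k ⟨S, rfl, hS⟩
    exact le_card_of_adjoin_eq S hS
  · have h := basic_isHomogeneous j
    have hd : basicDegree j 0 + basicDegree j 1 + basicDegree j 2 =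
        ![2, 2, 2, 3, 3, 4, 4, 5, 5, 5, 5, 6, 6, 6, 7, 7, 7, 7] j := by
      fin_cases j <;> rfl
    rwa [hd] at h

theorem isHSOP_params : IsHSOP ![2, 2, 3] params ![2, 2, 3, 4, 5, 5, 6] :=
  ⟨params_mem, fun j => by fin_cases j <;> decide, params_isHomogeneous,
    algebraicIndependent_params, fun _ => isIntegral_paramAlg⟩

end BinInv

open BinInv in
/-- For `V = 2V₂ ⊕ V₃`: there is a homogeneous system of parameters of degrees
`2, 2, 3, 4, 5, 5, 6`, and the minimal number of generators is `18`, with degrees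
`2, 2, 2, 3, 3, 4, 4, 5, 5, 5, 5, 6, 6, 6, 7, 7, 7, 7`. -/
theorem twoV2_V3_hsop_and_generators :
    (∃ P : Fin 7 → MvPolynomial (Idx ![2, 2, 3]) ℂ,
      IsHSOP ![2, 2, 3] P ![2, 2, 3, 4, 5, 5, 6]) ∧
    HasMinimalGens ![2, 2, 3]
      ![2, 2, 2, 3, 3, 4, 4, 5, 5, 5, 5, 6, 6, 6, 7, 7, 7, 7] := by
  exact ⟨⟨params, isHSOP_params⟩, hasMinimalGens⟩
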